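/- arXiv:1301.3436 — 4 statements merged into one kernel-verified Lean document; each statement's English description precedes it below -/
import Mathlib

section
/- Let ε > 0 and μ > 0, let B ⊂ ℝ² be the open disk of radius ε centered at the origin, and let v be a C¹ complex-valued function on the closed disk. Then ∫_B ( μ·‖∇v(x)‖² − |v(x)|²/‖x‖ ) dx ≥ −(1/μ + 2/ε)·∫_B |v(x)|² dx. -/
open MeasureTheory

/-- The Coulomb uncertainty inequality along a ray, with the planar weight `r`. The boundary terms
vanish on integrating the derivative of `r (1 - r / ε) ‖w r‖²`. -/
lemma ray_inequality {ε μ : ℝ} (hε : 0 < ε) (hμ : 0 < μ) {w w' : ℝ → ℂ} {G : ℝ → ℝ}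
    (hw : ∀ r, HasDerivAt w (w' r) r) (hw' : Continuous w') (hG : Continuous G)
    (hwG : ∀ r, ‖w' r‖ ^ 2 ≤ G r) :
    0 ≤ ∫ r in (0 : ℝ)..ε, (r * (μ * G r + (1 / μ + 2 / ε) * ‖w r‖ ^ 2) - ‖w r‖ ^ 2) := by
  have hwc : Continuous w := continuous_iff_continuousAt.2 fun r => (hw r).continuousAt
  have hderiv : ∀ r, HasDerivAt (fun r => -(r * (1 - r / ε) * ‖w r‖ ^ 2))
      (-((1 - 2 * r / ε) * ‖w r‖ ^ 2 + r * (1 - r / ε) * (2 * inner ℝ (w r) (w' r)))) r := by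
    intro r
    have h1 : HasDerivAt (fun r : ℝ => r * (1 - r / ε)) (1 - 2 * r / ε) r := by
      exact ((hasDerivAt_id' r).fun_mul (((hasDerivAt_id' r).div_const ε).const_sub 1)).congr_deriv
        (by ring)
    exact (h1.mul (hw r).norm_sq).neg
  have hint := intervalIntegral.integral_eq_sub_of_hasDerivAt (a := 0) (b := ε)
    (fun r _ => hderiv r) (Continuous.intervalIntegrable (by fun_prop) _ _)
  simp only [div_self hε.ne', sub_self, mul_zero, zero_mul, neg_zero] at hint
  refine hint.symm.trans_le ?_
  apply intervalIntegral.integral_mono_on hε.le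
  · exact Continuous.intervalIntegrable (by fun_prop) _ _
  · exact Continuous.intervalIntegrable (by fun_prop) _ _
  intro r hr
  have hr1 : r / ε ≤ 1 := (div_le_one hε).2 hr.2
  have hr0 : 0 ≤ r / ε := div_nonneg hr.1 hε.le
  have hcs : -inner ℝ (w r) (w' r) ≤ ‖w r‖ * ‖w' r‖ :=
    (neg_le_abs _).trans (abs_real_inner_le_norm _ _)
  have hyoung : 2 * (‖w r‖ * ‖w' r‖) ≤ μ * ‖w' r‖ ^ 2 + 1 / μ * ‖w r‖ ^ 2 := by
    have : μ * ‖w' r‖ ^ 2 + 1 / μ * ‖w r‖ ^ 2 - 2 * (‖w r‖ * ‖w' r‖)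
        = 1 / μ * (μ * ‖w' r‖ - ‖w r‖) ^ 2 := by field_simp; ring
    have : 0 ≤ 1 / μ * (μ * ‖w' r‖ - ‖w r‖) ^ 2 := by positivity
    linarith
  have hcut : (1 - r / ε) * -(2 * inner ℝ (w r) (w' r)) ≤ μ * G r + 1 / μ * ‖w r‖ ^ 2 := by
    calc (1 - r / ε) * -(2 * inner ℝ (w r) (w' r))
        ≤ (1 - r / ε) * (2 * (‖w r‖ * ‖w' r‖)) :=
          mul_le_mul_of_nonneg_left (by linarith) (by linarith)
      _ ≤ 1 * (2 * (‖w r‖ * ‖w' r‖)) :=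
          mul_le_mul_of_nonneg_right (by linarith) (by positivity)
      _ ≤ μ * G r + 1 / μ * ‖w r‖ ^ 2 := by
          have := mul_le_mul_of_nonneg_left (hwG r) hμ.le
          linarith
  have := mul_le_mul_of_nonneg_left hcut hr.1
  have e : 2 * r / ε = r * (2 / ε) := by ring
  rw [e]
  linarith

lemma norm_sq_apply_le_sum_single {ι F : Type*} [Fintype ι] [DecidableEq ι]
    [NormedAddCommGroup F] [NormedSpace ℝ F] (f : EuclideanSpace ℝ ι →L[ℝ] F)
    (e : EuclideanSpace ℝ ι) :
    ‖f e‖ ^ 2 ≤ ‖e‖ ^ 2 * ∑ i, ‖f (EuclideanSpace.single i (1 : ℝ))‖ ^ 2 := by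
  have he : f e = ∑ i, e i • f (EuclideanSpace.single i (1 : ℝ)) := by
    conv_lhs => rw [← (EuclideanSpace.basisFun ι ℝ).sum_repr e]
    simp
  calc ‖f e‖ ^ 2 ≤ (∑ i, ‖e i‖ * ‖f (EuclideanSpace.single i (1 : ℝ))‖) ^ 2 := by
        gcongr
        rw [he]
        exact (norm_sum_le _ _).trans_eq (by simp [norm_smul])
    _ ≤ _ := by
        rw [EuclideanSpace.norm_sq_eq]
        exact Finset.sum_mul_sq_le_sq_mul_sq _ _ _

/-- An integral over a planar disk is nonnegative if all its radial integrals are; no integrability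
is needed since a non-integrable function has integral `0`. -/
lemma setIntegral_ball_nonneg_of_radial {ε : ℝ} (g : EuclideanSpace ℝ (Fin 2) → ℝ)
    (hg : ∀ e : EuclideanSpace ℝ (Fin 2), ‖e‖ = 1 → 0 ≤ ∫ r in Set.Ioo 0 ε, r * g (r • e)) :
    0 ≤ ∫ x in Metric.ball 0 ε, g x := by
  let L := Complex.orthonormalBasisOneI.repr
  rw [← integral_indicator measurableSet_ball,
    ← L.measurePreserving.integral_comp L.toHomeomorph.measurableEmbedding,
    ← Complex.integral_comp_polarCoord_symm]
  by_cases hint : IntegrableOn (fun p : ℝ × ℝ => p.1 • (Metric.ball 0 ε).indicator g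
      (L (Complex.polarCoord.symm p))) polarCoord.target
  swap
  · exact (integral_undef hint).ge
  rw [polarCoord_target] at hint ⊢
  rw [Measure.volume_eq_prod, ← setIntegral_prod_swap, setIntegral_prod _ (by exact hint.swap)]
  refine integral_nonneg fun θ => ?_
  let e := L (Real.cos θ + Real.sin θ * Complex.I)
  have he : ‖e‖ = 1 := by
    rw [L.norm_map, Complex.ofReal_cos, Complex.ofReal_sin, Complex.norm_cos_add_sin_mul_I]
  have hpolar (r : ℝ) : L (Complex.polarCoord.symm (r, θ)) = r • e := by
    rw [Complex.polarCoord_symm_apply, ← map_smul, Complex.real_smul]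
  simp only [Prod.swap_prod_mk, Pi.zero_apply, hpolar]
  have hind : Set.EqOn (fun r : ℝ => r • (Metric.ball 0 ε).indicator g (r • e))
      ((Set.Iio ε).indicator fun r => r * g (r • e)) (Set.Ioi 0) := by
    intro r hr
    have hnorm : ‖r • e‖ = r := by rw [norm_smul, he, mul_one, Real.norm_of_nonneg (le_of_lt hr)]
    by_cases h : r < ε <;> simp [Set.indicator, hnorm, h]
  rw [setIntegral_congr_fun measurableSet_Ioi hind, setIntegral_indicator measurableSet_Iio,
    Set.Ioi_inter_Iio]
  exact hg e he


/-- **2D Coulomb uncertainty lemma** (adaptation of Dyson–Lenard Lemma 2).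
For a `C¹` function `v` on the closed disk of radius `ε` in `ℝ²` and `μ > 0`,
`∫_B (μ‖∇v‖² - |v|²/‖x‖) ≥ -(1/μ + 2/ε)·∫_B |v|²`. -/
theorem coulomb_uncertainty_disk
    (ε μ : ℝ) (hε : 0 < ε) (hμ : 0 < μ)
    (v : EuclideanSpace ℝ (Fin 2) → ℂ) (hv : ContDiff ℝ 1 v) :
    (∫ x in Metric.ball (0 : EuclideanSpace ℝ (Fin 2)) ε,
        (μ * ∑ i : Fin 2, ‖fderiv ℝ v x (EuclideanSpace.single i (1 : ℝ))‖ ^ 2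
          - ‖v x‖ ^ 2 / ‖x‖))
      ≥ -(1 / μ + 2 / ε) *
        ∫ x in Metric.ball (0 : EuclideanSpace ℝ (Fin 2)) ε, ‖v x‖ ^ 2 := by
  have hfc : Continuous (fderiv ℝ v) := hv.continuous_fderiv one_ne_zero
  have hvc := hv.continuous
  set c := 1 / μ + 2 / ε with hc
  have hc0 : 0 ≤ c := by positivity
  set grad : EuclideanSpace ℝ (Fin 2) → ℝ :=
    fun x => ∑ i : Fin 2, ‖fderiv ℝ v x (EuclideanSpace.single i (1 : ℝ))‖ ^ 2
  have hgc : Continuous grad := by fun_prop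
  have hv2 : IntegrableOn (fun x => ‖v x‖ ^ 2) (Metric.ball 0 ε) :=
    ((hvc.norm.pow 2).continuousOn.integrableOn_compact (isCompact_closedBall 0 ε)).mono_set
      Metric.ball_subset_closedBall
  by_cases hint : IntegrableOn (fun x => μ * grad x - ‖v x‖ ^ 2 / ‖x‖) (Metric.ball 0 ε)
  swap
  · rw [integral_undef hint, ge_iff_le, neg_mul, neg_nonpos]
    exact mul_nonneg hc0 (integral_nonneg fun _ => by positivity)
  have hmain : 0 ≤ ∫ x in Metric.ball 0 ε,
      ((μ * grad x - ‖v x‖ ^ 2 / ‖x‖) + c * ‖v x‖ ^ 2) := by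
    refine setIntegral_ball_nonneg_of_radial _ fun e he => ?_
    have hline (r : ℝ) : HasDerivAt (fun r : ℝ => v (r • e)) (fderiv ℝ v (r • e) e) r := by
      have h := (hv.differentiable one_ne_zero (r • e)).hasFDerivAt.comp_hasDerivAt r
        ((hasDerivAt_id r).smul_const e)
      rw [one_smul] at h
      exact h
    have hray := ray_inequality hε hμ (G := fun r => grad (r • e)) hline (by fun_prop)
      (by fun_prop) fun r => by
        simpa only [he, one_pow, one_mul] using norm_sq_apply_le_sum_single (fderiv ℝ v (r • e)) e
    rw [intervalIntegral.integral_of_le hε.le, integral_Ioc_eq_integral_Ioo] at hray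
    refine hray.trans_eq (setIntegral_congr_fun measurableSet_Ioo fun r hr => ?_)
    have hr0 : r ≠ 0 := hr.1.ne'
    simp only [norm_smul, he, mul_one, Real.norm_of_nonneg hr.1.le]
    rw [← hc]
    field_simp
    ring
  rw [integral_add hint (hv2.const_mul c), integral_const_mul] at hmain
  linarith
end

section
/- Let α ≥ 1 and l > 0. Then for every C¹ function u : [0, l] → ℂ with u(0) = 0, ∫_0^l ( |u′(r)|² + α(α−1)·|u(r)|²/r² ) dr ≥ ((π²/4 + α(α−1))/l²) · ∫_0^l |u(r)|² dr. (In particular the spectral gap ξ_H(α) of the pairwise relative Calogero–Sutherland operator −d²/dr² + α(α−1)/r² on [−l,l] with Neumann conditions at r = ±l satisfies ξ_H(α) ≥ √(π²/4 + α(α−1)) for α ≥ 1.) -/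
open MeasureTheory intervalIntegral

/-- A differentiable curve vanishing at `0` is `r` times its (continuous) slope at `0`. -/
theorem eq_smul_dslope_zero {u : ℝ → ℂ} (h0 : u 0 = 0) (r : ℝ) :
    u r = r • dslope u 0 r := by
  simpa [h0] using (sub_smul_dslope u 0 r).symm

theorem Differentiable.continuous_dslope_zero {u : ℝ → ℂ} (hu : Differentiable ℝ u) :
    Continuous (dslope u 0) := by
  rw [continuous_iff_continuousAt]
  intro r
  rcases eq_or_ne r 0 with rfl | hr
  · exact continuousAt_dslope_same.2 (hu 0)
  · exact (continuousAt_dslope_of_ne hr).2 (hu r).continuousAt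

theorem intervalIntegrable_norm_sq_div_sq {u : ℝ → ℂ} (hu : Differentiable ℝ u) (h0 : u 0 = 0)
    (a b : ℝ) : IntervalIntegrable (fun r => ‖u r‖ ^ 2 / r ^ 2) volume a b := by
  have hc : Continuous fun r => ‖dslope u 0 r‖ ^ 2 := hu.continuous_dslope_zero.norm.pow 2
  refine (hc.intervalIntegrable a b).congr_ae (ae_restrict_of_ae ?_)
  filter_upwards [Measure.ae_ne volume (0 : ℝ)] with r hr
  rw [eq_smul_dslope_zero h0 r, norm_smul, mul_pow, Real.norm_eq_abs, sq_abs]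
  field_simp

/-- The Wirtinger inequality with Dirichlet condition at `0` and free condition at `l`. -/
theorem wirtinger_dirichlet_neumann {l : ℝ} (hl : 0 < l) {u : ℝ → ℂ} (hu : ContDiff ℝ 1 u)
    (h0 : u 0 = 0) :
    (Real.pi / (2 * l)) ^ 2 * ∫ r in (0:ℝ)..l, ‖u r‖ ^ 2 ≤ ∫ r in (0:ℝ)..l, ‖deriv u r‖ ^ 2 := by
  set k : ℝ := Real.pi / (2 * l) with hk
  have hkpos : 0 < k := by positivity
  have hkl : k * l = Real.pi / 2 := by rw [hk]; field_simp
  have hd : Differentiable ℝ u := hu.differentiable one_ne_zero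
  have hu' : Continuous (deriv u) := hu.continuous_deriv le_rfl
  have hsin : ∀ r ∈ Set.Ioc 0 l, 0 < Real.sin (k * r) := fun r hr =>
    Real.sin_pos_of_pos_of_lt_pi (mul_pos hkpos hr.1)
      (by nlinarith [mul_le_mul_of_nonneg_left hr.2 hkpos.le, Real.pi_pos])
  set F : ℝ → ℝ := fun r => k * Real.cos (k * r) / Real.sin (k * r) * ‖u r‖ ^ 2 with hF
  have hcont : ContinuousOn F (Set.Icc 0 l) := by
    have hG : ContinuousOn
        (fun r => Real.cos (k * r) * (r * ‖dslope u 0 r‖ ^ 2) / Real.sinc (k * r))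
        (Set.Icc 0 l) := by
      have hdc := hd.continuous_dslope_zero
      have hsc : Continuous fun r => Real.sinc (k * r) :=
        Real.continuous_sinc.comp (by fun_prop)
      refine ContinuousOn.div (by fun_prop) hsc.continuousOn fun r hr => ?_
      rcases hr.1.eq_or_lt with rfl | hr0
      · simp
      · rw [Real.sinc_of_ne_zero (by positivity)]
        exact (div_pos (hsin r ⟨hr0, hr.2⟩) (by positivity)).ne'
    refine hG.congr fun r hr => ?_
    rcases hr.1.eq_or_lt with rfl | hr0
    · simp [hF, h0]
    · have := (hsin r ⟨hr0, hr.2⟩).ne'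
      simp only [hF]
      rw [Real.sinc_of_ne_zero (by positivity), eq_smul_dslope_zero h0 r, norm_smul, mul_pow,
        Real.norm_eq_abs, sq_abs]
      field_simp
  have hderiv : ∀ r ∈ Set.Ioo 0 l, HasDerivAt F
      (((k * (-Real.sin (k * r) * k)) * Real.sin (k * r)
          - k * Real.cos (k * r) * (Real.cos (k * r) * k)) / Real.sin (k * r) ^ 2 * ‖u r‖ ^ 2
        + k * Real.cos (k * r) / Real.sin (k * r) * (2 * inner ℝ (u r) (deriv u r))) r := by
    intro r hr
    have hlin : HasDerivAt (fun r : ℝ => k * r) k r := by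
      simpa using (hasDerivAt_id r).const_mul k
    exact ((hlin.cos.const_mul k).div hlin.sin (hsin r ⟨hr.1, hr.2.le⟩).ne').mul
      (hd r).hasDerivAt.norm_sq
  have hint : IntervalIntegrable (fun r => ‖deriv u r‖ ^ 2) volume 0 l :=
    (hu'.norm.pow 2).intervalIntegrable 0 l
  have hint' : IntervalIntegrable (fun r => k ^ 2 * ‖u r‖ ^ 2) volume 0 l :=
    ((hd.continuous.norm.pow 2).const_mul _).intervalIntegrable 0 l
  have key : F l - F 0 ≤ ∫ r in (0:ℝ)..l, (‖deriv u r‖ ^ 2 - k ^ 2 * ‖u r‖ ^ 2) := by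
    refine sub_le_integral_of_hasDeriv_right_of_le hl.le hcont
      (fun r hr => (hderiv r hr).hasDerivWithinAt)
      ((intervalIntegrable_iff_integrableOn_Icc_of_le hl.le).1 (hint.sub hint')) fun r hr => ?_
    have hs := (hsin r ⟨hr.1, hr.2.le⟩).ne'
    have hsq := norm_sub_sq_real (deriv u r) ((k * Real.cos (k * r) / Real.sin (k * r)) • u r)
    rw [inner_smul_right, norm_smul, mul_pow, Real.norm_eq_abs, sq_abs,
      real_inner_comm] at hsq
    have hcoef : ((k * (-Real.sin (k * r) * k)) * Real.sin (k * r)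
          - k * Real.cos (k * r) * (Real.cos (k * r) * k)) / Real.sin (k * r) ^ 2
        = -k ^ 2 - (k * Real.cos (k * r) / Real.sin (k * r)) ^ 2 := by
      field_simp
    rw [hcoef]
    nlinarith [sq_nonneg
      ‖deriv u r - (k * Real.cos (k * r) / Real.sin (k * r)) • u r‖]
  have hFl : F l = 0 := by simp [hF, hkl]
  have hF0 : F 0 = 0 := by simp [hF]
  rw [integral_sub hint hint', intervalIntegral.integral_const_mul, hFl, hF0] at key
  linarith

/-- **Pairwise relative Calogero–Sutherland bound.** For `α ≥ 1`, `l > 0`, and any `C¹`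
function `u : [0,l] → ℂ` with `u(0) = 0`,
`∫₀^l (|u'|² + α(α-1)|u|²/r²) ≥ ((π²/4 + α(α-1))/l²)·∫₀^l |u|²`;
in particular `ξ_H(α)² ≥ π²/4 + α(α-1)` for `α ≥ 1`. -/
theorem pairwise_relative_calogero_sutherland
    (α l : ℝ) (hα : 1 ≤ α) (hl : 0 < l)
    (u : ℝ → ℂ) (hu : ContDiff ℝ 1 u) (h0 : u 0 = 0) :
    (∫ r in (0:ℝ)..l, (‖deriv u r‖ ^ 2 + α * (α - 1) * ‖u r‖ ^ 2 / r ^ 2))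
      ≥ ((Real.pi ^ 2 / 4 + α * (α - 1)) / l ^ 2) * ∫ r in (0:ℝ)..l, ‖u r‖ ^ 2 := by
  have hd : Differentiable ℝ u := hu.differentiable one_ne_zero
  have hc : 0 ≤ α * (α - 1) := mul_nonneg (by linarith) (by linarith)
  have hint : IntervalIntegrable (fun r => ‖deriv u r‖ ^ 2) volume 0 l :=
    ((hu.continuous_deriv le_rfl).norm.pow 2).intervalIntegrable 0 l
  have hpot := intervalIntegrable_norm_sq_div_sq hd h0 0 l
  have hmass : IntervalIntegrable (fun r => ‖u r‖ ^ 2 / l ^ 2) volume 0 l :=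
    ((hd.continuous.norm.pow 2).div_const _).intervalIntegrable 0 l
  have hmono : (∫ r in (0:ℝ)..l, ‖u r‖ ^ 2 / l ^ 2) ≤ ∫ r in (0:ℝ)..l, ‖u r‖ ^ 2 / r ^ 2 := by
    refine integral_mono_on_of_le_Ioo hl.le hmass hpot fun r hr => ?_
    have := hr.1
    have := hr.2.le
    gcongr
  rw [intervalIntegral.integral_div] at hmono
  have hW := wirtinger_dirichlet_neumann hl hu h0
  have hP := mul_le_mul_of_nonneg_left hmono hc
  simp only [mul_div_assoc (α * (α - 1))]
  rw [integral_add hint (hpot.const_mul _), intervalIntegral.integral_const_mul]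
  refine (le_of_eq ?_).trans (add_le_add hW hP)
  field_simp
  ring
end

section
/- Let α ≥ 1, n ≥ 2, and let Q ⊂ ℝ be a finite interval of length |Q| > 0. Then for every smooth symmetric function ψ : ℝⁿ → ℂ that vanishes on a neighborhood of the diagonal set {x ∈ ℝⁿ : x_j = x_k for some j ≠ k}, ∫_{Qⁿ} [ (1/2)·∑_{j=1}ⁿ |∂_j ψ|² + ∑_{1≤j<k≤n} α(α−1)·|ψ|²/(x_j − x_k)² ] dx ≥ (n−1)·((π²/4 + α(α−1))/|Q|²)·∫_{Qⁿ} |ψ|² dx. -/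
open MeasureTheory Set Filter Topology

/-- Sharp Poincaré inequality on `[c, d]` for a function vanishing near the left endpoint. -/
lemma sq_mul_integral_norm_sq_le_of_eventuallyEq_zero_left {f f' : ℝ → ℂ} {c d K : ℝ}
    (hf : ∀ t, HasDerivAt f (f' t) t) (hf' : Continuous f') (h0 : f =ᶠ[𝓝 c] 0)
    (hcd : c ≤ d) (hK : 0 < K) (hKd : K * (d - c) ≤ Real.pi / 2) :
    K ^ 2 * ∫ t in c..d, ‖f t‖ ^ 2 ≤ ∫ t in c..d, ‖f' t‖ ^ 2 := by
  have hfc : Continuous f := continuous_iff_continuousAt.2 fun t => (hf t).continuousAt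
  have hsin : ∀ t ∈ Ioc c d, 0 < Real.sin (K * (t - c)) := fun t ht => by
    have h1 : 0 < K * (t - c) := mul_pos hK (sub_pos.2 ht.1)
    have h2 : K * (t - c) ≤ K * (d - c) := by gcongr; exact ht.2
    exact Real.sin_pos_of_pos_of_lt_pi h1 (by linarith [Real.pi_pos])
  set g : ℝ → ℝ := fun t =>
    K * (Real.cos (K * (t - c)) / Real.sin (K * (t - c))) * ‖f t‖ ^ 2 with hg
  have hderiv : ∀ t ∈ Ioc c d, HasDerivAt g
      (-K ^ 2 * (1 + (Real.cos (K * (t - c)) / Real.sin (K * (t - c))) ^ 2) * ‖f t‖ ^ 2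
        + K * (Real.cos (K * (t - c)) / Real.sin (K * (t - c))) * (2 * inner ℝ (f t) (f' t)))
      t := fun t ht => by
    have hs := (hsin t ht).ne'
    have hl : HasDerivAt (fun t => K * (t - c)) K t := by
      simpa using ((hasDerivAt_id t).sub_const c).const_mul K
    have hq := ((hl.cos.div hl.sin hs).const_mul K).mul (hf t).norm_sq
    refine hq.congr_deriv ?_
    have hsq := Real.sin_sq_add_cos_sq (K * (t - c))
    simp only [Pi.div_apply]
    congr 2
    field_simp
    ring
  have hcont : ContinuousOn g (Icc c d) := by
    intro t ht
    rcases ht.1.eq_or_lt with rfl | hlt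
    · have : g =ᶠ[𝓝 c] fun _ => 0 := by
        filter_upwards [h0] with s hs
        simp [hg, hs]
      exact (continuousAt_const.congr this.symm).continuousWithinAt
    · exact (hderiv t ⟨hlt, ht.2⟩).continuousAt.continuousWithinAt
  have hint1 : IntervalIntegrable (fun t => ‖f' t‖ ^ 2) volume c d :=
    (by fun_prop : Continuous fun t => ‖f' t‖ ^ 2).intervalIntegrable _ _
  have hint2 : IntervalIntegrable (fun t => K ^ 2 * ‖f t‖ ^ 2) volume c d :=
    (by fun_prop : Continuous fun t => K ^ 2 * ‖f t‖ ^ 2).intervalIntegrable _ _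
  have key := intervalIntegral.sub_le_integral_of_hasDeriv_right_of_le
    (φ := fun t => ‖f' t‖ ^ 2 - K ^ 2 * ‖f t‖ ^ 2) hcd hcont
    (fun t ht => (hderiv t ⟨ht.1, ht.2.le⟩).hasDerivWithinAt)
    (by fun_prop : Continuous fun t => ‖f' t‖ ^ 2 - K ^ 2 * ‖f t‖ ^ 2).integrableOn_Icc
    (fun t _ => by
      set q := Real.cos (K * (t - c)) / Real.sin (K * (t - c))
      have hi := sq_nonneg ‖f' t - (K * q) • f t‖
      rw [@norm_sub_sq_real, norm_smul, real_inner_smul_right, mul_pow, Real.norm_eq_abs, sq_abs,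
        real_inner_comm] at hi
      nlinarith)
  rw [intervalIntegral.integral_sub hint1 hint2, intervalIntegral.integral_const_mul] at key
  have hgc : g c = 0 := by simp [hg, h0.eq_of_nhds]
  have hgd : 0 ≤ g d := by
    have h1 : 0 ≤ K * (d - c) := mul_nonneg hK.le (sub_nonneg.2 hcd)
    have h2 : 0 ≤ Real.cos (K * (d - c)) :=
      Real.cos_nonneg_of_neg_pi_div_two_le_of_le (by linarith [Real.pi_pos]) hKd
    have h3 : 0 ≤ Real.sin (K * (d - c)) :=
      Real.sin_nonneg_of_nonneg_of_le_pi h1 (by linarith [Real.pi_pos])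
    exact mul_nonneg (mul_nonneg hK.le (div_nonneg h2 h3)) (sq_nonneg _)
  linarith

/-- Sharp Poincaré inequality on `[c, d]` for a function vanishing near the right endpoint. -/
lemma sq_mul_integral_norm_sq_le_of_eventuallyEq_zero_right {f f' : ℝ → ℂ} {c d K : ℝ}
    (hf : ∀ t, HasDerivAt f (f' t) t) (hf' : Continuous f') (h0 : f =ᶠ[𝓝 d] 0)
    (hcd : c ≤ d) (hK : 0 < K) (hKd : K * (d - c) ≤ Real.pi / 2) :
    K ^ 2 * ∫ t in c..d, ‖f t‖ ^ 2 ≤ ∫ t in c..d, ‖f' t‖ ^ 2 := by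
  have h0' : (fun t => f (-t)) =ᶠ[𝓝 (-d)] 0 := by
    have ht : Tendsto (fun t : ℝ => -t) (𝓝 (-d)) (𝓝 d) := by
      simpa using (continuous_neg (G := ℝ)).tendsto (-d)
    exact ht.eventually h0
  have h := sq_mul_integral_norm_sq_le_of_eventuallyEq_zero_left (f := fun t => f (-t))
    (f' := fun t => -f' (-t)) (c := -d) (d := -c) (K := K)
    (fun t => ((hf (-t)).scomp t (hasDerivAt_neg t)).congr_deriv (by simp))
    (by fun_prop) h0' (by linarith) hK (by linarith)
  simp only [norm_neg] at h
  rw [intervalIntegral.integral_comp_neg (fun t => ‖f t‖ ^ 2),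
    intervalIntegral.integral_comp_neg (fun t => ‖f' t‖ ^ 2)] at h
  simpa using h

/-- A function on `[a, b]` vanishing near each of finitely many points satisfies the mixed
Dirichlet–Neumann bound everywhere, and the four times larger Dirichlet bound between the points. -/
lemma integral_norm_deriv_sq_sub_nonneg {ι : Type*} [Finite ι] [Nonempty ι] {f f' : ℝ → ℂ}
    {a b K : ℝ} (hf : ∀ t, HasDerivAt f (f' t) t) (hf' : Continuous f') (y : ι → ℝ)
    (hy : ∀ i, y i ∈ Icc a b) (h0 : ∀ i, f =ᶠ[𝓝 (y i)] 0) (hK : 0 < K)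
    (hKab : K * (b - a) ≤ Real.pi / 2) :
    0 ≤ ∫ t in Icc a b, (‖f' t‖ ^ 2 - (K ^ 2 * ‖f t‖ ^ 2 +
      {t | (∃ i, y i < t) ∧ ∃ i, t < y i}.indicator (fun t => 3 * K ^ 2 * ‖f t‖ ^ 2) t)) := by
  obtain ⟨i₀, hi₀⟩ := Finite.exists_min y
  obtain ⟨i₁, hi₁⟩ := Finite.exists_max y
  have hset : {t | (∃ i, y i < t) ∧ ∃ i, t < y i} = Ioo (y i₀) (y i₁) := by
    ext t
    exact ⟨fun ⟨⟨i, hi⟩, k, hk⟩ => ⟨(hi₀ i).trans_lt hi, hk.trans_le (hi₁ k)⟩,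
      fun h => ⟨⟨i₀, h.1⟩, i₁, h.2⟩⟩
  rw [hset]
  obtain ⟨ha, hb⟩ : a ≤ y i₀ ∧ y i₁ ≤ b := ⟨(hy i₀).1, (hy i₁).2⟩
  have hmM := hi₀ i₁
  have h0m := h0 i₀
  have h0M := h0 i₁
  generalize y i₀ = m at *
  generalize y i₁ = M at *
  have hfc : Continuous f := continuous_iff_continuousAt.2 fun t => (hf t).continuousAt
  have hcont : ∀ k : ℝ, Continuous fun t => ‖f' t‖ ^ 2 - k * ‖f t‖ ^ 2 := fun k => by fun_prop
  set φ : ℝ → ℝ := fun t => ‖f' t‖ ^ 2 - (K ^ 2 * ‖f t‖ ^ 2 +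
      (Ioo m M).indicator (fun t => 3 * K ^ 2 * ‖f t‖ ^ 2) t) with hφ
  have hi : ∀ c d, IntervalIntegrable φ volume c d := fun c d => by
    have h1 : IntervalIntegrable (fun t => ‖f' t‖ ^ 2) volume c d :=
      (by fun_prop : Continuous fun t => ‖f' t‖ ^ 2).intervalIntegrable _ _
    have h2 : IntervalIntegrable (fun t => K ^ 2 * ‖f t‖ ^ 2) volume c d :=
      (by fun_prop : Continuous fun t => K ^ 2 * ‖f t‖ ^ 2).intervalIntegrable _ _
    have h3 : IntervalIntegrable (fun t => 3 * K ^ 2 * ‖f t‖ ^ 2) volume c d :=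
      (by fun_prop : Continuous fun t => 3 * K ^ 2 * ‖f t‖ ^ 2).intervalIntegrable _ _
    exact h1.sub (h2.add ⟨h3.1.indicator measurableSet_Ioo, h3.2.indicator measurableSet_Ioo⟩)
  have hle : ∀ (k c d : ℝ), c ≤ d → (∀ t ∈ Icc c d, ‖f' t‖ ^ 2 - k * ‖f t‖ ^ 2 ≤ φ t) →
      k * (∫ t in c..d, ‖f t‖ ^ 2) ≤ (∫ t in c..d, ‖f' t‖ ^ 2) → 0 ≤ ∫ t in c..d, φ t := by
    intro k c d hcd h1 h2
    have h3 := intervalIntegral.integral_mono_on hcd ((hcont k).intervalIntegrable _ _) (hi c d) h1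
    rw [intervalIntegral.integral_sub
      ((by fun_prop : Continuous fun t => ‖f' t‖ ^ 2).intervalIntegrable _ _)
      ((by fun_prop : Continuous fun t => k * ‖f t‖ ^ 2).intervalIntegrable _ _),
      intervalIntegral.integral_const_mul] at h3
    linarith
  have hout : ∀ t, t ∉ Ioo m M → ‖f' t‖ ^ 2 - K ^ 2 * ‖f t‖ ^ 2 ≤ φ t := fun t ht => by
    simp [hφ, indicator_of_notMem ht]
  have hin : ∀ t, ‖f' t‖ ^ 2 - (2 * K) ^ 2 * ‖f t‖ ^ 2 ≤ φ t := fun t => by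
    have h : (Ioo m M).indicator (fun t => 3 * K ^ 2 * ‖f t‖ ^ 2) t ≤ 3 * K ^ 2 * ‖f t‖ ^ 2 :=
      indicator_le_self' (fun _ _ => by positivity) t
    simp only [hφ]
    linarith
  have hsub : ∀ c d, a ≤ c → d ≤ b → K * (d - c) ≤ Real.pi / 2 := fun c d h1 h2 =>
    (mul_le_mul_of_nonneg_left (by linarith) hK.le).trans hKab
  have hmid := hsub m M ha hb
  have p1 := hle (K ^ 2) a m ha (fun t ht => hout t fun h => h.1.not_ge ht.2)
    (sq_mul_integral_norm_sq_le_of_eventuallyEq_zero_right hf hf' h0m ha hK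
      (hsub a m le_rfl (hmM.trans hb)))
  have p2 := hle ((2 * K) ^ 2) m ((m + M) / 2) (by linarith) (fun t _ => hin t)
    (sq_mul_integral_norm_sq_le_of_eventuallyEq_zero_left hf hf' h0m (by linarith)
      (by linarith) (by linarith))
  have p3 := hle ((2 * K) ^ 2) ((m + M) / 2) M (by linarith) (fun t _ => hin t)
    (sq_mul_integral_norm_sq_le_of_eventuallyEq_zero_right hf hf' h0M (by linarith)
      (by linarith) (by linarith))
  have p4 := hle (K ^ 2) M b hb (fun t ht => hout t fun h => h.2.not_ge ht.1)
    (sq_mul_integral_norm_sq_le_of_eventuallyEq_zero_left hf hf' h0M hb hK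
      (hsub M b (ha.trans hmM) le_rfl))
  rw [integral_Icc_eq_integral_Ioc, ← intervalIntegral.integral_of_le (by linarith),
    ← intervalIntegral.integral_add_adjacent_intervals (hi a m) (hi m b),
    ← intervalIntegral.integral_add_adjacent_intervals (hi m ((m + M) / 2)) (hi _ b),
    ← intervalIntegral.integral_add_adjacent_intervals (hi ((m + M) / 2) M) (hi M b)]
  linarith

/-- The integral over a cube is nonnegative if all integrals in the `j`-th coordinate are. -/
lemma setIntegral_pi_nonneg_of_insertNth {m : ℕ} (j : Fin (m + 1)) {s : Set ℝ}
    (hs : MeasurableSet s) {F : (Fin (m + 1) → ℝ) → ℝ}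
    (hF : IntegrableOn F (univ.pi fun _ => s))
    (h : ∀ y ∈ univ.pi fun _ : Fin m => s, 0 ≤ ∫ t in s, F (j.insertNth t y)) :
    0 ≤ ∫ x in univ.pi fun _ => s, F x := by
  set e := MeasurableEquiv.piFinSuccAbove (fun _ : Fin (m + 1) => ℝ) j
  have hmp : MeasurePreserving e volume volume :=
    volume_preserving_piFinSuccAbove (fun _ : Fin (m + 1) => ℝ) j
  have hpre : e ⁻¹' (s ×ˢ univ.pi fun _ : Fin m => s) = univ.pi fun _ => s := by
    ext x
    simp only [mem_preimage, mem_prod, mem_univ_pi]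
    rw [Fin.forall_iff_succAbove j]
    rfl
  have hint : IntegrableOn (fun p => F (e.symm p)) (s ×ˢ univ.pi fun _ : Fin m => s) := by
    rw [← hmp.integrableOn_comp_preimage e.measurableEmbedding, hpre]
    simpa [Function.comp_def] using hF
  have hcongr : ∫ x in univ.pi fun _ => s, F x
      = ∫ p in s ×ˢ univ.pi fun _ : Fin m => s, F (e.symm p) := by
    rw [← hmp.setIntegral_preimage_emb e.measurableEmbedding, hpre]
    simp
  rw [hcongr]
  rw [IntegrableOn, Measure.volume_eq_prod, ← Measure.prod_restrict] at hint
  rw [Measure.volume_eq_prod, ← Measure.prod_restrict, integral_prod_symm _ hint]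
  exact setIntegral_nonneg (MeasurableSet.univ_pi fun _ => hs) h

lemma measurableSet_strictly_between {n : ℕ} (j : Fin n) :
    MeasurableSet {x : Fin n → ℝ | (∃ i, x i < x j) ∧ ∃ i, x j < x i} := by
  refine IsOpen.measurableSet (IsOpen.and ?_ ?_)
  · simp only [ofPred_exists]
    exact isOpen_iUnion fun i => isOpen_lt (continuous_apply i) (continuous_apply j)
  · simp only [ofPred_exists]
    exact isOpen_iUnion fun i => isOpen_lt (continuous_apply j) (continuous_apply i)

/-- Kinetic energy of the `j`-th particle bounded below by the mass, with a fourfold constant on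
the region where the particle lies strictly between two others. -/
lemma integral_norm_fderiv_single_sq_ge {m : ℕ} (hm : 1 ≤ m) {a b K : ℝ} (hK : 0 < K)
    (hKab : K * (b - a) ≤ Real.pi / 2) {ψ : (Fin (m + 1) → ℝ) → ℂ} (hψ : ContDiff ℝ 1 ψ)
    (h0 : ∀ (x : Fin (m + 1) → ℝ) (i k : Fin (m + 1)), i ≠ k → x i = x k → ψ =ᶠ[𝓝 x] 0)
    (j : Fin (m + 1)) :
    ∫ x in univ.pi fun _ : Fin (m + 1) => Icc a b, (K ^ 2 * ‖ψ x‖ ^ 2 +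
        {x : Fin (m + 1) → ℝ | (∃ i, x i < x j) ∧ ∃ i, x j < x i}.indicator
          (fun x => 3 * K ^ 2 * ‖ψ x‖ ^ 2) x)
      ≤ ∫ x in univ.pi fun _ : Fin (m + 1) => Icc a b,
        ‖fderiv ℝ ψ x (Pi.single j 1)‖ ^ 2 := by
  have hcpt : IsCompact (univ.pi fun _ : Fin (m + 1) => Icc a b) :=
    isCompact_univ_pi fun _ => isCompact_Icc
  have hc := hψ.continuous
  have hd : Continuous fun x => fderiv ℝ ψ x (Pi.single j 1) :=
    (hψ.continuous_fderiv one_ne_zero).clm_apply continuous_const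
  have hint1 : IntegrableOn (fun x => ‖fderiv ℝ ψ x (Pi.single j 1)‖ ^ 2)
      (univ.pi fun _ : Fin (m + 1) => Icc a b) :=
    (hd.norm.pow 2).continuousOn.integrableOn_compact hcpt
  have hint2 : IntegrableOn (fun x => K ^ 2 * ‖ψ x‖ ^ 2 +
        {x : Fin (m + 1) → ℝ | (∃ i, x i < x j) ∧ ∃ i, x j < x i}.indicator
          (fun x => 3 * K ^ 2 * ‖ψ x‖ ^ 2) x) (univ.pi fun _ : Fin (m + 1) => Icc a b) :=
    ((continuous_const.mul (hc.norm.pow 2)).continuousOn.integrableOn_compact hcpt).add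
      (((continuous_const.mul (hc.norm.pow 2)).continuousOn.integrableOn_compact hcpt).indicator
        (measurableSet_strictly_between j))
  rw [← sub_nonneg, ← integral_sub hint1 hint2]
  refine setIntegral_pi_nonneg_of_insertNth j measurableSet_Icc (hint1.sub hint2) fun y hy => ?_
  have : Nonempty (Fin m) := ⟨⟨0, hm⟩⟩
  have hupd : (fun t : ℝ => j.insertNth (α := fun _ => ℝ) t y)
      = Function.update (j.insertNth (α := fun _ => ℝ) 0 y) j := by
    funext t
    exact (Fin.update_insertNth (α := fun _ => ℝ) j 0 t y).symm
  have hins : ∀ t : ℝ, HasDerivAt (fun t : ℝ => j.insertNth (α := fun _ => ℝ) t y)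
      (Pi.single j 1) t := fun t => by
    rw [hupd]
    exact hasDerivAt_update _ j t
  have hinsc : Continuous fun t : ℝ => j.insertNth (α := fun _ => ℝ) t y :=
    continuous_iff_continuousAt.2 fun t => (hins t).continuousAt
  have key := integral_norm_deriv_sq_sub_nonneg
    (f := fun t => ψ (j.insertNth (α := fun _ => ℝ) t y))
    (f' := fun t => fderiv ℝ ψ (j.insertNth (α := fun _ => ℝ) t y) (Pi.single j 1))
    (fun t => ((hψ.differentiable one_ne_zero _).hasFDerivAt.comp_hasDerivAt t (hins t)))
    (hd.comp hinsc) y (fun i => hy i (mem_univ i))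
    (fun i => (hinsc.tendsto (y i)).eventually
      (h0 _ j (j.succAbove i) (Fin.succAbove_ne j i).symm (by simp)))
    hK hKab
  have hbetween : ∀ t : ℝ, {x : Fin (m + 1) → ℝ | (∃ i, x i < x j) ∧ ∃ i, x j < x i}.indicator
      (fun x => 3 * K ^ 2 * ‖ψ x‖ ^ 2) (j.insertNth (α := fun _ => ℝ) t y)
      = {t | (∃ i, y i < t) ∧ ∃ i, t < y i}.indicator
        (fun t => 3 * K ^ 2 * ‖ψ (j.insertNth (α := fun _ => ℝ) t y)‖ ^ 2) t := fun t => by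
    simp only [indicator_apply, mem_ofPred_eq, Fin.exists_iff_succAbove j,
      Fin.insertNth_apply_same, Fin.insertNth_apply_succAbove, lt_irrefl, false_or]
  simpa only [hbetween] using key

/-- Among `n` distinct reals, all but two lie strictly between two others. -/
lemma card_sub_two_mul_le_sum_indicator {n : ℕ} (hn : 2 ≤ n) {x : Fin n → ℝ}
    (hx : Function.Injective x) {C : ℝ} (hC : 0 ≤ C) :
    ((n : ℝ) - 2) * C ≤ ∑ j : Fin n,
      {x : Fin n → ℝ | (∃ i, x i < x j) ∧ ∃ i, x j < x i}.indicator (fun _ => C) x := by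
  have : Nonempty (Fin n) := ⟨⟨0, by omega⟩⟩
  obtain ⟨i₀, hi₀⟩ := Finite.exists_min x
  obtain ⟨i₁, hi₁⟩ := Finite.exists_max x
  have hle : ∀ j : Fin n, C - ((if j = i₀ then C else 0) + if j = i₁ then C else 0) ≤
      {x : Fin n → ℝ | (∃ i, x i < x j) ∧ ∃ i, x j < x i}.indicator (fun _ => C) x := fun j => by
    by_cases h : j = i₀ ∨ j = i₁
    · refine le_trans ?_ (indicator_nonneg (fun _ _ => hC) x)
      rcases h with rfl | rfl
      · simp only [if_true]; split_ifs <;> linarith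
      · simp only [if_true]; split_ifs <;> linarith
    · push Not at h
      have hmem : x ∈ {x : Fin n → ℝ | (∃ i, x i < x j) ∧ ∃ i, x j < x i} :=
        ⟨⟨i₀, (hi₀ j).lt_of_ne fun e => h.1 (hx e).symm⟩,
          ⟨i₁, (hi₁ j).lt_of_ne fun e => h.2 (hx e)⟩⟩
      simp [indicator_of_mem hmem, h.1, h.2]
  refine le_trans (le_of_eq ?_) (Finset.sum_le_sum fun j _ => hle j)
  simp [Finset.sum_sub_distrib, Finset.sum_add_distrib]
  ring

lemma continuous_norm_sq_div_sub_sq {n : ℕ} {ψ : (Fin n → ℝ) → ℂ} (hψ : Continuous ψ) (c : ℝ)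
    {j k : Fin n} (h0 : ∀ x : Fin n → ℝ, x j = x k → ψ =ᶠ[𝓝 x] 0) :
    Continuous fun x => c * ‖ψ x‖ ^ 2 / (x j - x k) ^ 2 := by
  refine continuous_iff_continuousAt.2 fun x => ?_
  by_cases h : x j = x k
  · have : (fun x => c * ‖ψ x‖ ^ 2 / (x j - x k) ^ 2) =ᶠ[𝓝 x] fun _ => 0 := by
      filter_upwards [h0 x h] with z hz
      simp [hz]
    exact continuousAt_const.congr this.symm
  · exact ContinuousAt.div (by fun_prop) (by fun_prop) (pow_ne_zero 2 (sub_ne_zero.2 h))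

/-- On a cube the pair potential is at least its value at the maximal distance for the pairs
containing the first particle. -/
lemma mul_norm_sq_le_sum_pair_potential {n : ℕ} (hn : 2 ≤ n) {a b c r : ℝ} (hc : 0 ≤ c)
    (hr : 0 ≤ r) {x : Fin n → ℝ} (hx : ∀ i, x i ∈ Icc a b) (hinj : Function.Injective x) :
    ((n : ℝ) - 1) * (c / (b - a) ^ 2) * r ≤
      ∑ j : Fin n, ∑ k ∈ Finset.univ.filter (fun k => j < k), c * r / (x j - x k) ^ 2 := by
  set o : Fin n := ⟨0, by omega⟩ with ho
  have hnn : ∀ j ∈ Finset.univ,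
      0 ≤ ∑ k ∈ Finset.univ.filter (fun k => j < k), c * r / (x j - x k) ^ 2 := fun j _ =>
    Finset.sum_nonneg fun k _ => by positivity
  refine le_trans ?_ (Finset.single_le_sum hnn (Finset.mem_univ o))
  have hcard : (Finset.univ.filter (fun k => o < k)).card = n - 1 := by
    have : Finset.univ.filter (fun k => o < k) = Finset.Ioi o := by ext; simp
    rw [this, Fin.card_Ioi]
    simp [ho]
  have hconst : ((n : ℝ) - 1) * (c / (b - a) ^ 2) * r
      = ∑ _k ∈ Finset.univ.filter (fun k => o < k), c * r / (b - a) ^ 2 := by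
    rw [Finset.sum_const, hcard, nsmul_eq_mul, Nat.cast_sub (by omega)]
    push_cast
    ring
  rw [hconst]
  refine Finset.sum_le_sum fun k hk => ?_
  have hne : x o - x k ≠ 0 := sub_ne_zero.2 fun e => (Finset.mem_filter.1 hk).2.ne (hinj e)
  have hsq : (x o - x k) ^ 2 ≤ (b - a) ^ 2 :=
    sq_le_sq' (by linarith [(hx o).1, (hx k).2]) (by linarith [(hx o).2, (hx k).1])
  exact div_le_div_of_nonneg_left (mul_nonneg hc hr) (by positivity) hsq

/-- **Local exclusion for the Calogero–Sutherland model.** For `α ≥ 1`, `n ≥ 2`, a finite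
interval `Q = [a,b]` and a smooth symmetric wave function `ψ` vanishing on a neighborhood
of the diagonals, the local Calogero–Sutherland energy on `Qⁿ` is at least
`(n-1)·(π²/4 + α(α-1))/|Q|²` times the local mass. -/
theorem local_exclusion_calogero_sutherland
    (α : ℝ) (hα : 1 ≤ α) (n : ℕ) (hn : 2 ≤ n) (a b : ℝ) (hab : a < b)
    (ψ : (Fin n → ℝ) → ℂ) (hψ : ContDiff ℝ (⊤ : ℕ∞) ψ)
    (hsym : ∀ (σ : Equiv.Perm (Fin n)) (x : Fin n → ℝ), ψ (x ∘ σ) = ψ x)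
    (hvan : ∃ U : Set (Fin n → ℝ), IsOpen U ∧
      {x : Fin n → ℝ | ∃ j k : Fin n, j ≠ k ∧ x j = x k} ⊆ U ∧ ∀ x ∈ U, ψ x = 0) :
    (∫ x in Set.univ.pi fun _ : Fin n => Set.Icc a b,
        ((1 / 2) * ∑ j : Fin n, ‖fderiv ℝ ψ x (Pi.single j 1)‖ ^ 2
          + ∑ j : Fin n, ∑ k ∈ Finset.univ.filter (fun k => j < k),
              α * (α - 1) * ‖ψ x‖ ^ 2 / (x j - x k) ^ 2))
      ≥ ((n : ℝ) - 1) * ((Real.pi ^ 2 / 4 + α * (α - 1)) / (b - a) ^ 2) *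
        ∫ x in Set.univ.pi fun _ : Fin n => Set.Icc a b, ‖ψ x‖ ^ 2 := by
  obtain ⟨m, rfl⟩ : ∃ m, n = m + 1 := ⟨n - 1, by omega⟩
  obtain ⟨U, hU, hdiag, hzero⟩ := hvan
  have h0 : ∀ (x : Fin (m + 1) → ℝ) (i k : Fin (m + 1)), i ≠ k → x i = x k → ψ =ᶠ[𝓝 x] 0 :=
    fun x i k hik hx => Filter.eventually_of_mem (hU.mem_nhds (hdiag ⟨i, k, hik, hx⟩)) hzero
  have hψ1 : ContDiff ℝ 1 ψ := hψ.of_le (by exact_mod_cast le_top)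
  have hc := hψ1.continuous
  have hL : 0 < b - a := sub_pos.2 hab
  have hπ := Real.pi_pos
  have hα' : 0 ≤ α * (α - 1) := mul_nonneg (by linarith) (by linarith)
  set K : ℝ := Real.pi / (2 * (b - a)) with hK
  have hK0 : 0 < K := by positivity
  have hKab : K * (b - a) ≤ Real.pi / 2 := by
    rw [hK]
    apply le_of_eq
    field_simp
  set Q : Set (Fin (m + 1) → ℝ) := univ.pi fun _ : Fin (m + 1) => Icc a b with hQ
  have hcpt : IsCompact Q := isCompact_univ_pi fun _ => isCompact_Icc
  have hQm : MeasurableSet Q := MeasurableSet.univ_pi fun _ => measurableSet_Icc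
  have hint : ∀ {F : (Fin (m + 1) → ℝ) → ℝ}, Continuous F → IntegrableOn F Q :=
    fun hF => hF.continuousOn.integrableOn_compact hcpt
  have hd : ∀ j, Continuous fun x => ‖fderiv ℝ ψ x (Pi.single j 1)‖ ^ 2 := fun j =>
    ((hψ1.continuous_fderiv one_ne_zero).clm_apply continuous_const).norm.pow 2
  have hV : IntegrableOn (fun x => ∑ j : Fin (m + 1), ∑ k ∈ Finset.univ.filter (fun k => j < k),
      α * (α - 1) * ‖ψ x‖ ^ 2 / (x j - x k) ^ 2) Q :=
    hint (continuous_finsetSum _ fun j _ => continuous_finsetSum _ fun k hk =>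
      continuous_norm_sq_div_sub_sq hc _ fun x =>
        h0 x j k (Finset.mem_filter.1 hk).2.ne)
  have hW : ∀ j : Fin (m + 1), IntegrableOn (fun x => K ^ 2 * ‖ψ x‖ ^ 2 +
      {x : Fin (m + 1) → ℝ | (∃ i, x i < x j) ∧ ∃ i, x j < x i}.indicator
        (fun x => 3 * K ^ 2 * ‖ψ x‖ ^ 2) x) Q := fun j =>
    (hint (by fun_prop)).add
      (IntegrableOn.indicator (hint (by fun_prop)) (measurableSet_strictly_between j))
  have hkin := Finset.sum_le_sum fun (j : Fin (m + 1)) (_ : j ∈ Finset.univ) =>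
    integral_norm_fderiv_single_sq_ge (by omega) hK0 hKab hψ1 h0 j
  rw [← hQ, ← integral_finsetSum _ fun j _ => hW j,
    ← integral_finsetSum _ fun j _ => hint (hd j)] at hkin
  rw [integral_add ((hint (continuous_finsetSum _ fun j _ => hd j)).const_mul _) hV,
    integral_const_mul, ge_iff_le]
  refine le_trans ?_ (add_le_add_left (mul_le_mul_of_nonneg_left hkin (by norm_num)) _)
  rw [← integral_const_mul, ← integral_const_mul,
    ← integral_add ((integrable_finsetSum _ fun j _ => hW j).const_mul _) hV]
  refine setIntegral_mono_on (hint (by fun_prop))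
    (((integrable_finsetSum _ fun j _ => hW j).const_mul _).add hV) hQm fun x hx => ?_
  by_cases hz : ψ x = 0
  · simp [hz, indicator_apply]
  have hinj : Function.Injective x := fun i k hik => by
    by_contra hne
    exact hz (h0 x i k hne hik).eq_of_nhds
  have hpot := mul_norm_sq_le_sum_pair_potential hn hα' (sq_nonneg ‖ψ x‖)
    (fun i => hx i (mem_univ i)) hinj
  have hcount := card_sub_two_mul_le_sum_indicator hn hinj
    (C := 3 * K ^ 2 * ‖ψ x‖ ^ 2) (by positivity)
  have hsplit : (Real.pi ^ 2 / 4 + α * (α - 1)) / (b - a) ^ 2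
      = K ^ 2 + α * (α - 1) / (b - a) ^ 2 := by
    rw [hK]
    field_simp
    ring
  have hmass : 0 ≤ K ^ 2 * ‖ψ x‖ ^ 2 := by positivity
  have hn' : (2 : ℝ) ≤ ((m + 1 : ℕ) : ℝ) := by exact_mod_cast hn
  have hkin' : (((m + 1 : ℕ) : ℝ) - 1) * K ^ 2 * ‖ψ x‖ ^ 2 ≤
      1 / 2 * ∑ j : Fin (m + 1), (K ^ 2 * ‖ψ x‖ ^ 2 +
        {x : Fin (m + 1) → ℝ | (∃ i, x i < x j) ∧ ∃ i, x j < x i}.indicator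
          (fun x => 3 * K ^ 2 * ‖ψ x‖ ^ 2) x) := by
    rw [Finset.sum_add_distrib, Finset.sum_const, Finset.card_univ, Fintype.card_fin, nsmul_eq_mul]
    simp only [indicator_apply] at hcount ⊢
    nlinarith
  rw [hsplit]
  linarith
end

section
/- Let α ∈ ℝ, n ≥ 2, and let Ω ⊂ ℝ² be an open square of area |Ω|. Then for every smooth symmetric function ψ : (ℝ²)ⁿ → ℂ whose support is disjoint from the diagonal set Δ = {x : x_j = x_k for some j ≠ k}, ∫_{Ωⁿ} ∑_{j=1}ⁿ ‖D_j ψ‖² dx ≥ (n−1)·(0.112·C_{α,n}²/|Ω|)·∫_{Ωⁿ} |ψ|² dx. -/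
open MeasureTheory

/-- The anyonic exclusion constant
`C_{α,n} = min_{p ∈ {0,…,n-2}, q ∈ ℤ} |(2p+1)α - 2q|`. -/
noncomputable def Calpha (α : ℝ) (n : ℕ) : ℝ :=
  sInf {c : ℝ | ∃ p : ℕ, ∃ q : ℤ, p ≤ n - 2 ∧ c = |(2 * (p : ℝ) + 1) * α - 2 * (q : ℝ)|}

/-- The `i`-th component of the Aharonov–Bohm magnetic potential
`A_j(x) = α ∑_{k ≠ j} (x_j - x_k)^⊥/|x_j - x_k|²` felt by the `j`-th anyon. -/
noncomputable def anyonA (α : ℝ) {n : ℕ} (x : Fin n → EuclideanSpace ℝ (Fin 2))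
    (j : Fin n) (i : Fin 2) : ℝ :=
  α * ∑ k ∈ Finset.univ.filter (fun k => k ≠ j),
    (if i = 0 then -(x j 1 - x k 1) else x j 0 - x k 0) / ‖x j - x k‖ ^ 2

/-- The `i`-th component of the anyonic magnetic derivative
`D_jψ = -i∇_{x_j}ψ + A_j ψ`. -/
noncomputable def anyonD (α : ℝ) {n : ℕ} (ψ : (Fin n → EuclideanSpace ℝ (Fin 2)) → ℂ)
    (x : Fin n → EuclideanSpace ℝ (Fin 2)) (j : Fin n) (i : Fin 2) : ℂ :=
  (-Complex.I) * fderiv ℝ ψ x (Pi.single j (EuclideanSpace.single i (1 : ℝ)))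
    + (anyonA α x j i : ℂ) * ψ x

section phases

/-- A total phase `(2p+1)πα` with `p ≤ n - 2` stays at distance at least `2 C_{α,n}` from `1`. -/
lemma two_mul_Calpha_le_norm_exp_sub_one (α : ℝ) {n p : ℕ} (hp : p ≤ n - 2) {φ : ℝ}
    (hφ : |φ| = |(2 * (p : ℝ) + 1) * α * Real.pi|) :
    2 * Calpha α n ≤ ‖Complex.exp (Complex.I * φ) - 1‖ := by
  set y : ℝ := (2 * (p : ℝ) + 1) * α with hy
  have hbdd : BddBelow {c : ℝ | ∃ p : ℕ, ∃ q : ℤ, p ≤ n - 2 ∧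
      c = |(2 * (p : ℝ) + 1) * α - 2 * (q : ℝ)|} :=
    ⟨0, by rintro c ⟨p, q, -, rfl⟩; exact abs_nonneg _⟩
  have hC : Calpha α n ≤ |y - 2 * (round (y / 2) : ℤ)| :=
    csInf_le hbdd ⟨p, round (y / 2), hp, rfl⟩
  have hround := abs_sub_round (y / 2)
  set δ : ℝ := y / 2 - round (y / 2) with hδ
  have hsin : 2 * |δ| ≤ |Real.sin (Real.pi * δ)| := by
    have hπ := Real.pi_pos
    have h : |Real.pi * δ| ≤ Real.pi / 2 := by
      rw [abs_mul, abs_of_pos hπ]; nlinarith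
    have := Real.mul_abs_le_abs_sin h
    rw [abs_mul, abs_of_pos hπ] at this
    calc 2 * |δ| = 2 / Real.pi * (Real.pi * |δ|) := by field_simp
      _ ≤ _ := this
  have hsin' : |Real.sin (Real.pi * δ)| = |Real.sin (φ / 2)| := by
    have h1 : Real.pi * δ = y * Real.pi / 2 - (round (y / 2) : ℤ) * Real.pi := by
      rw [hδ]; ring
    rw [h1, Real.sin_sub_int_mul_pi, abs_mul, abs_zpow, abs_neg, abs_one, one_zpow, one_mul]
    rcases abs_eq_abs.mp hφ with h | h
    · rw [h]
    · rw [h, neg_div, Real.sin_neg, abs_neg]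
  have h2 : |y - 2 * (round (y / 2) : ℤ)| = 2 * |δ| := by
    rw [← abs_two, ← abs_mul, hδ, abs_two]; congr 1; ring
  rw [Complex.norm_exp_I_mul_ofReal_sub_one, Real.norm_eq_abs, abs_mul, abs_two, ← hsin']
  linarith

lemma arctan_add_arctan_inv {x : ℝ} (hx : x ≠ 0) :
    Real.arctan x + Real.arctan x⁻¹ = Real.pi / 2 * SignType.sign x := by
  rcases lt_or_gt_of_ne hx with h | h
  · rw [Real.arctan_inv_of_neg h, sign_neg h]; simp
  · rw [Real.arctan_inv_of_pos h, sign_pos h]; simp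

lemma arctan_div_add_arctan_div {a b : ℝ} (ha : a ≠ 0) (hb : b ≠ 0) :
    Real.arctan (a / b) + Real.arctan (b / a) =
      Real.pi / 2 * ((SignType.sign a : ℝ) * SignType.sign b) := by
  rw [← inv_div a b, arctan_add_arctan_inv (div_ne_zero ha hb)]
  rcases lt_or_gt_of_ne ha with h | h <;> rcases lt_or_gt_of_ne hb with h' | h'
  · simp [sign_neg h, sign_neg h', sign_pos (div_pos_of_neg_of_neg h h')]
  · simp [sign_neg h, sign_pos h', sign_neg (div_neg_of_neg_of_pos h h')]
  · simp [sign_pos h, sign_neg h', sign_neg (div_neg_of_pos_of_neg h h')]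
  · simp [sign_pos h, sign_pos h', sign_pos (div_pos h h')]

/-- A rectangular loop with opposite corners `P` and `Q` winds around the origin
either not at all, or exactly once with the orientation `sign (P₁ - Q₁) * sign (P₂ - Q₂)`. -/
lemma arctan_rectangle_winding {P₁ P₂ Q₁ Q₂ : ℝ} (hP₁ : P₁ ≠ 0) (hP₂ : P₂ ≠ 0) (hQ₁ : Q₁ ≠ 0)
    (hQ₂ : Q₂ ≠ 0) :
    ∃ b : Prop, ∃ _ : Decidable b,
      (Real.arctan (P₁ / P₂) - Real.arctan (Q₁ / P₂)) +
      (Real.arctan (Q₁ / Q₂) - Real.arctan (P₁ / Q₂)) +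
      (Real.arctan (Q₂ / Q₁) - Real.arctan (P₂ / Q₁)) +
      (Real.arctan (P₂ / P₁) - Real.arctan (Q₂ / P₁)) =
      (SignType.sign (P₁ - Q₁) : ℝ) * SignType.sign (P₂ - Q₂) *
        (if b then 2 * Real.pi else 0) := by
  have h : (Real.arctan (P₁ / P₂) - Real.arctan (Q₁ / P₂)) +
      (Real.arctan (Q₁ / Q₂) - Real.arctan (P₁ / Q₂)) +
      (Real.arctan (Q₂ / Q₁) - Real.arctan (P₂ / Q₁)) +
      (Real.arctan (P₂ / P₁) - Real.arctan (Q₂ / P₁)) =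
      Real.pi / 2 * (((SignType.sign P₁ : ℝ) - SignType.sign Q₁) *
        ((SignType.sign P₂ : ℝ) - SignType.sign Q₂)) := by
    linear_combination arctan_div_add_arctan_div hP₁ hP₂ + arctan_div_add_arctan_div hQ₁ hQ₂
      - arctan_div_add_arctan_div hQ₁ hP₂ - arctan_div_add_arctan_div hP₁ hQ₂
  have key : ∀ {a b : ℝ}, a ≠ 0 → b ≠ 0 → (SignType.sign a : ℝ) - SignType.sign b = 0 ∨
      (SignType.sign a : ℝ) - SignType.sign b = 2 * SignType.sign (a - b) := by
    intro a b ha hb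
    rcases lt_or_gt_of_ne ha with h | h <;> rcases lt_or_gt_of_ne hb with h' | h'
    · simp [sign_neg h, sign_neg h']
    · right; rw [sign_neg h, sign_pos h', sign_neg (by linarith)]; norm_num
    · right; rw [sign_pos h, sign_neg h', sign_pos (by linarith)]; norm_num
    · simp [sign_pos h, sign_pos h']
  rw [h]
  rcases key hP₁ hQ₁ with h1 | h1
  · exact ⟨False, inferInstance, by simp [h1]⟩
  rcases key hP₂ hQ₂ with h2 | h2
  · exact ⟨False, inferInstance, by simp [h2]⟩
  · refine ⟨True, inferInstance, ?_⟩
    rw [h1, h2, if_pos trivial]; ring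

end phases

section moves

variable {n : ℕ}

/-- The unit vector along the `i`-th coordinate of the `j`-th particle. -/
noncomputable def coordDir (j : Fin n) (i : Fin 2) : Fin n → EuclideanSpace ℝ (Fin 2) :=
  Pi.single j (EuclideanSpace.single i (1 : ℝ))

/-- The configuration `x` with the `i`-th coordinate of the `j`-th particle replaced by `t`. -/
noncomputable def setCoord (x : Fin n → EuclideanSpace ℝ (Fin 2)) (j : Fin n) (i : Fin 2) (t : ℝ) :
    Fin n → EuclideanSpace ℝ (Fin 2) :=
  x + (t - x j i) • coordDir j i

lemma setCoord_apply (x : Fin n → EuclideanSpace ℝ (Fin 2)) (j : Fin n) (i : Fin 2) (t : ℝ)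
    (k : Fin n) (l : Fin 2) :
    setCoord x j i t k l = if k = j ∧ l = i then t else x k l := by
  by_cases hk : k = j
  · subst hk
    by_cases hl : l = i
    · subst hl; simp [setCoord, coordDir]
    · simp [setCoord, coordDir, hl]
  · simp [setCoord, coordDir, hk]

lemma config_ext {x y : Fin n → EuclideanSpace ℝ (Fin 2)} (h : ∀ k l, x k l = y k l) : x = y := by
  ext k l; exact h k l

lemma setCoord_eq_self {x : Fin n → EuclideanSpace ℝ (Fin 2)} {j : Fin n} {i : Fin 2} {t : ℝ}
    (h : x j i = t) : setCoord x j i t = x := by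
  simp [setCoord, h]

lemma continuous_setCoord (x : Fin n → EuclideanSpace ℝ (Fin 2)) (j : Fin n) (i : Fin 2) :
    Continuous (setCoord x j i) := by
  unfold setCoord; fun_prop

lemma hasDerivAt_setCoord (x : Fin n → EuclideanSpace ℝ (Fin 2)) (j : Fin n) (i : Fin 2) (t : ℝ) :
    HasDerivAt (setCoord x j i) (coordDir j i) t := by
  exact ((((hasDerivAt_id t).sub_const (x j i)).smul_const (coordDir j i)).const_add x).congr_deriv
    (one_smul ℝ _)

lemma continuous_anyonD (α : ℝ) {ψ : (Fin n → EuclideanSpace ℝ (Fin 2)) → ℂ}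
    (hψ : ContDiff ℝ (⊤ : ℕ∞) ψ)
    (hsupp : ∀ x ∈ tsupport ψ, ∀ j k : Fin n, j ≠ k → x j ≠ x k) (j : Fin n) (i : Fin 2) :
    Continuous fun x => anyonD α ψ x j i := by
  rw [continuous_iff_continuousAt]
  intro x
  by_cases hx : x ∈ tsupport ψ
  · have h1 : Continuous (fderiv ℝ ψ) := hψ.continuous_fderiv (by simp)
    have h2 : ContinuousAt (fun x => anyonA α x j i) x := by
      unfold anyonA
      refine ContinuousAt.mul continuousAt_const ?_
      refine tendsto_finsetSum _ fun k hk => ?_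
      have hne : ‖x j - x k‖ ^ 2 ≠ 0 := by
        have := hsupp x hx j k (Ne.symm (Finset.mem_filter.mp hk).2)
        simpa [sub_eq_zero] using this
      refine ContinuousAt.div ?_ ?_ hne
      · split_ifs <;> fun_prop
      · fun_prop
    have h3 : Continuous ψ := hψ.continuous
    unfold anyonD
    refine ContinuousAt.add ?_ ?_
    · exact (continuous_const.mul (h1.clm_apply continuous_const)).continuousAt
    · exact (Complex.continuous_ofReal.continuousAt.comp h2).mul h3.continuousAt
  · have hev : (fun x => anyonD α ψ x j i) =ᶠ[nhds x] fun _ => 0 := by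
      filter_upwards [(isClosed_tsupport ψ).isOpen_compl.mem_nhds hx] with y hy
      have hy0 : ψ y = 0 := image_eq_zero_of_notMem_tsupport hy
      have hy1 : fderiv ℝ ψ y = 0 := by
        have := notMem_tsupport_iff_eventuallyEq.mp hy
        rw [this.fderiv_eq]; simp
      simp [anyonD, hy0, hy1]
    exact continuousAt_const.congr hev.symm

/-- The contribution of one other particle to the phase picked up along a line in direction `i`,
at transversal offset `d` and longitudinal offset `u`. -/
noncomputable def pairPhase (i : Fin 2) (d u : ℝ) : ℝ :=
  if i = 0 then -Real.arctan (u / d) else Real.arctan (u / d)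

/-- An antiderivative in `t` of the `i`-th component of the potential felt by particle `j`
when its `i`-th coordinate is `t`. -/
noncomputable def linePhase (α : ℝ) (x : Fin n → EuclideanSpace ℝ (Fin 2)) (j : Fin n) (i : Fin 2)
    (t : ℝ) : ℝ :=
  α * ∑ k ∈ Finset.univ.filter (fun k => k ≠ j), pairPhase i (x j (1 - i) - x k (1 - i)) (t - x k i)

lemma hasDerivAt_arctan_sub_div (u : ℝ) {d : ℝ} (hd : d ≠ 0) (t : ℝ) :
    HasDerivAt (fun t => Real.arctan ((t - u) / d)) (d / ((t - u) ^ 2 + d ^ 2)) t := by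
  refine (((hasDerivAt_id' t).sub_const u).div_const d).arctan.congr_deriv ?_
  have : (t - u) ^ 2 + d ^ 2 ≠ 0 := by positivity
  have : d ^ 2 + (t - u) ^ 2 ≠ 0 := by positivity
  field_simp
  ring

lemma hasDerivAt_linePhase (α : ℝ) {x : Fin n → EuclideanSpace ℝ (Fin 2)} {j : Fin n} {i : Fin 2}
    (hx : ∀ k, k ≠ j → x j (1 - i) ≠ x k (1 - i)) (t : ℝ) :
    HasDerivAt (linePhase α x j i) (anyonA α (setCoord x j i t) j i) t := by
  unfold linePhase anyonA
  refine HasDerivAt.const_mul α (HasDerivAt.fun_sum fun k hk => ?_)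
  have hk' : k ≠ j := (Finset.mem_filter.mp hk).2
  have hat := hasDerivAt_arctan_sub_div (x k i) (sub_ne_zero.mpr (hx k hk')) t
  obtain rfl | rfl : i = 0 ∨ i = 1 := by omega
  · simp only [pairPhase, if_true]
    refine hat.neg.congr_deriv ?_
    simp [EuclideanSpace.norm_sq_eq, Fin.sum_univ_two, setCoord_apply, hk']
    ring
  · simp only [pairPhase, one_ne_zero, if_false]
    refine hat.congr_deriv ?_
    simp [EuclideanSpace.norm_sq_eq, Fin.sum_univ_two, setCoord_apply, hk']
    ring

lemma sq_setIntegral_Ioo_le {g : ℝ → ℝ} (hg : Continuous g) {c s : ℝ} (hs : 0 < s) :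
    (∫ t in Set.Ioo c (c + s), g t) ^ 2 ≤ s * ∫ t in Set.Ioo c (c + s), g t ^ 2 := by
  have hint : ∀ {f : ℝ → ℝ}, Continuous f → IntegrableOn f (Set.Ioo c (c + s)) := fun hf =>
    (hf.continuousOn.integrableOn_compact (isCompact_Icc (a := c) (b := c + s))).mono_set
      Set.Ioo_subset_Icc_self
  set m : ℝ := (∫ t in Set.Ioo c (c + s), g t) / s with hm
  have h1 : 0 ≤ ∫ t in Set.Ioo c (c + s), (g t ^ 2 - 2 * m * g t + m ^ 2) :=
    integral_nonneg fun t => by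
      have := sq_nonneg (g t - m)
      simp only [Pi.zero_apply]; nlinarith
  have hconst : ∫ _ in Set.Ioo c (c + s), m ^ 2 = s * m ^ 2 := by
    simp [hs.le]
  have hsplit : ∫ t in Set.Ioo c (c + s), (g t ^ 2 - 2 * m * g t + m ^ 2) =
      (∫ t in Set.Ioo c (c + s), g t ^ 2) - 2 * m * (∫ t in Set.Ioo c (c + s), g t) +
        s * m ^ 2 := by
    rw [integral_add (f := fun t => g t ^ 2 - 2 * m * g t) (hint (by fun_prop))
      (hint (by fun_prop)), integral_sub (hint (by fun_prop)) (hint (by fun_prop)),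
      integral_const_mul, hconst]
  rw [hsplit] at h1
  have h2 : ∫ t in Set.Ioo c (c + s), g t = m * s := by rw [hm]; field_simp
  rw [h2] at h1 ⊢
  nlinarith

/-- Moving a single coordinate of one particle, the gauge-transformed wave function changes by at
most the integral of the magnetic derivative along the segment. -/
lemma sq_norm_transport_sub_le (α : ℝ) {ψ : (Fin n → EuclideanSpace ℝ (Fin 2)) → ℂ}
    (hψ : ContDiff ℝ (⊤ : ℕ∞) ψ)
    (hsupp : ∀ x ∈ tsupport ψ, ∀ j k : Fin n, j ≠ k → x j ≠ x k)
    {x : Fin n → EuclideanSpace ℝ (Fin 2)} {j : Fin n} {i : Fin 2}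
    (hx : ∀ k, k ≠ j → x j (1 - i) ≠ x k (1 - i)) {c s a b : ℝ} (hs : 0 < s)
    (ha : a ∈ Set.Ioo c (c + s)) (hb : b ∈ Set.Ioo c (c + s)) :
    ‖Complex.exp (Complex.I * ((linePhase α x j i b - linePhase α x j i a : ℝ) : ℂ)) *
        ψ (setCoord x j i b) - ψ (setCoord x j i a)‖ ^ 2 ≤
      s * ∫ t in Set.Ioo c (c + s), ‖anyonD α ψ (setCoord x j i t) j i‖ ^ 2 := by
  have hDc : Continuous fun t => anyonD α ψ (setCoord x j i t) j i :=
    (continuous_anyonD α hψ hsupp j i).comp (continuous_setCoord x j i)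
  have hLd := hasDerivAt_linePhase α hx
  have hLc : Continuous (linePhase α x j i) :=
    continuous_iff_continuousAt.mpr fun t => (hLd t).continuousAt
  set L : ℝ → ℝ := fun t => linePhase α x j i t - linePhase α x j i a with hL
  have hLc' : Continuous L := hLc.sub continuous_const
  have hder : ∀ t, HasDerivAt
      (fun t => Complex.exp (Complex.I * (L t : ℂ)) * ψ (setCoord x j i t))
      (Complex.I * Complex.exp (Complex.I * (L t : ℂ)) *
        anyonD α ψ (setCoord x j i t) j i) t := by
    intro t
    have h1 := ((((hLd t).sub_const (linePhase α x j i a)).ofReal_comp).const_mul Complex.I).cexp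
    have h2 := ((hψ.differentiable (by simp)) (setCoord x j i t)).hasFDerivAt.comp_hasDerivAt t
      (hasDerivAt_setCoord x j i t)
    refine (h1.mul h2).congr_deriv ?_
    simp only [anyonD, coordDir, hL, Function.comp]
    linear_combination
      (Complex.exp (Complex.I * ((linePhase α x j i t - linePhase α x j i a : ℝ) : ℂ)) *
        fderiv ℝ ψ (setCoord x j i t) (Pi.single j (EuclideanSpace.single i 1))) * Complex.I_sq
  have hc' : Continuous fun t => Complex.I * Complex.exp (Complex.I * (L t : ℂ)) *
        anyonD α ψ (setCoord x j i t) j i := by fun_prop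
  have hftc := intervalIntegral.integral_eq_sub_of_hasDerivAt (fun t _ => hder t)
    (hc'.intervalIntegrable a b)
  have hLa : L a = 0 := by simp [hL]
  simp only [hLa, Complex.ofReal_zero, mul_zero, Complex.exp_zero, one_mul] at hftc
  have hnorm : ‖∫ t in a..b, Complex.I * Complex.exp (Complex.I * (L t : ℂ)) *
        anyonD α ψ (setCoord x j i t) j i‖ ≤
      ∫ t in Set.Ioo c (c + s), ‖anyonD α ψ (setCoord x j i t) j i‖ := by
    refine intervalIntegral.norm_integral_le_integral_norm_uIoc.trans ?_
    have heq : ∀ t, ‖Complex.I * Complex.exp (Complex.I * (L t : ℂ)) *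
        anyonD α ψ (setCoord x j i t) j i‖ = ‖anyonD α ψ (setCoord x j i t) j i‖ := by
      intro t
      rw [norm_mul, norm_mul, Complex.norm_I, Complex.norm_exp_I_mul_ofReal, one_mul, one_mul]
    simp only [heq]
    refine setIntegral_mono_set ?_ (Filter.Eventually.of_forall fun t => norm_nonneg _) ?_
    · exact (hDc.norm.continuousOn.integrableOn_compact
        (isCompact_Icc (a := c) (b := c + s))).mono_set Set.Ioo_subset_Icc_self
    · refine Filter.Eventually.of_forall fun t ht => ?_
      rcases Set.mem_uIoc.mp ht with h | h
      · exact ⟨ha.1.trans h.1, h.2.trans_lt hb.2⟩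
      · exact ⟨hb.1.trans h.1, h.2.trans_lt ha.2⟩
  rw [hftc] at hnorm
  refine le_trans ?_ (sq_setIntegral_Ioo_le hDc.norm hs)
  gcongr

end moves

section exchange

variable {n : ℕ}

/-- The linear map exchanging the `l`-th coordinates of the particles `j` and `k`. -/
noncomputable def swapCoord (l : Fin 2) (j k : Fin n) :
    (Fin n → EuclideanSpace ℝ (Fin 2)) →ₗ[ℝ] (Fin n → EuclideanSpace ℝ (Fin 2)) where
  toFun x := fun m => WithLp.toLp 2 fun i => if i = l then x (Equiv.swap j k m) i else x m i
  map_add' x y := by ext m i; by_cases h : i = l <;> simp [h]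
  map_smul' a x := by ext m i; by_cases h : i = l <;> simp [h]

lemma swapCoord_apply (l : Fin 2) (j k : Fin n) (x : Fin n → EuclideanSpace ℝ (Fin 2))
    (m : Fin n) (i : Fin 2) :
    swapCoord l j k x m i = if i = l then x (Equiv.swap j k m) i else x m i := rfl

lemma swapCoord_swapCoord (l : Fin 2) (j k : Fin n) (x : Fin n → EuclideanSpace ℝ (Fin 2)) :
    swapCoord l j k (swapCoord l j k x) = x :=
  config_ext fun m i => by by_cases h : i = l <;> simp [swapCoord_apply, h]

lemma swapCoord_one_swapCoord_zero (j k : Fin n) (x : Fin n → EuclideanSpace ℝ (Fin 2)) :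
    swapCoord 1 j k (swapCoord 0 j k x) = x ∘ Equiv.swap j k :=
  config_ext fun m i => by
    obtain rfl | rfl : i = 0 ∨ i = 1 := by omega
    all_goals simp [swapCoord_apply]

lemma injective_swapCoord_coord {x : Fin n → EuclideanSpace ℝ (Fin 2)}
    (hx : ∀ l, Function.Injective fun m => x m l) (l : Fin 2) (j k : Fin n) (i : Fin 2) :
    Function.Injective fun m => swapCoord l j k x m i := by
  by_cases h : i = l
  · simp only [swapCoord_apply, h, if_true]
    exact (hx l).comp (Equiv.swap j k).injective
  · simpa only [swapCoord_apply, h, if_false] using hx i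

lemma sum_filter_ne_eq_add {j k : Fin n} (hjk : j ≠ k) (f : Fin n → ℝ) :
    ∑ m ∈ Finset.univ.filter (fun m => m ≠ j), f m =
      f k + ∑ m ∈ Finset.univ.filter (fun m => m ≠ j ∧ m ≠ k), f m := by
  have h : Finset.univ.filter (fun m : Fin n => m ≠ j ∧ m ≠ k) =
      (Finset.univ.filter (fun m => m ≠ j)).erase k := by
    ext m; simp [and_comm]
  rw [h, Finset.add_sum_erase _ _ (by simpa using hjk.symm)]

/-- Exchanging two particles along the sides of the rectangle they span produces the phase
`±(2p+1)πα`, where `p` is the number of particles inside the rectangle. -/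
lemma exists_exchange_phase (α : ℝ) {x : Fin n → EuclideanSpace ℝ (Fin 2)}
    (hx : ∀ l, Function.Injective fun m => x m l) {j k : Fin n} (hjk : j ≠ k) :
    ∃ p : ℕ, p ≤ n - 2 ∧
      |(linePhase α x j 0 (x k 0) - linePhase α x j 0 (x j 0)) +
        (linePhase α (swapCoord 0 j k x) k 0 (x j 0) -
          linePhase α (swapCoord 0 j k x) k 0 (x k 0)) +
        (linePhase α (swapCoord 0 j k x) j 1 (x k 1) -
          linePhase α (swapCoord 0 j k x) j 1 (x j 1)) +
        (linePhase α (swapCoord 1 j k (swapCoord 0 j k x)) k 1 (x j 1) -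
          linePhase α (swapCoord 1 j k (swapCoord 0 j k x)) k 1 (x k 1))| =
      |(2 * (p : ℝ) + 1) * α * Real.pi| := by
  have hne : ∀ l {m m' : Fin n}, m ≠ m' → x m l - x m' l ≠ 0 := fun l m m' h =>
    sub_ne_zero.mpr ((hx l).ne h)
  have hwind : ∀ m, ∃ b : Prop, ∃ _ : Decidable b, m ≠ j ∧ m ≠ k → _ := fun m =>
    if h : m ≠ j ∧ m ≠ k then by
      obtain ⟨b, hb, e⟩ := arctan_rectangle_winding (hne 0 h.1.symm) (hne 1 h.1.symm)
        (hne 0 h.2.symm) (hne 1 h.2.symm)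
      exact ⟨b, hb, fun _ => e⟩
    else ⟨False, inferInstance, fun h' => absurd h' h⟩
  choose b hb hw using hwind
  set ε : ℝ := (SignType.sign (x j 0 - x k 0) : ℝ) * SignType.sign (x j 1 - x k 1) with hε
  set T : Finset (Fin n) := Finset.univ.filter (fun m => m ≠ j ∧ m ≠ k) with hT
  have hT' : Finset.univ.filter (fun m => m ≠ k ∧ m ≠ j) = T := by
    ext m; simp [hT, and_comm]
  have hεabs : |ε| = 1 := by
    have : ∀ {a : ℝ}, a ≠ 0 → |(SignType.sign a : ℝ)| = 1 := fun {a} ha => by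
      rcases lt_or_gt_of_ne ha with h | h
      · simp [sign_neg h]
      · simp [sign_pos h]
    rw [hε, abs_mul, this (hne 0 hjk), this (hne 1 hjk), one_mul]
  refine ⟨(T.filter b).card, ?_, ?_⟩
  · have hcard : T.card = n - 2 := by
      have : T = (Finset.univ.erase j).erase k := by ext m; simp [hT, and_comm]
      rw [this, Finset.card_erase_of_mem (by simpa using hjk.symm),
        Finset.card_erase_of_mem (Finset.mem_univ _), Finset.card_univ, Fintype.card_fin]
      omega
    exact (Finset.card_filter_le _ _).trans hcard.le
  · have hpair : Real.arctan ((x j 0 - x k 0) / (x j 1 - x k 1)) +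
        Real.arctan ((x j 1 - x k 1) / (x j 0 - x k 0)) = Real.pi / 2 * ε :=
      arctan_div_add_arctan_div (hne 0 hjk) (hne 1 hjk)
    have hsum : ∑ m ∈ T, ε * (if b m then 2 * Real.pi else 0) =
        ε * (2 * Real.pi * (T.filter b).card) := by
      rw [← Finset.mul_sum, ← Finset.sum_filter, Finset.sum_const, nsmul_eq_mul]; ring
    have htot : (linePhase α x j 0 (x k 0) - linePhase α x j 0 (x j 0)) +
        (linePhase α (swapCoord 0 j k x) k 0 (x j 0) -
          linePhase α (swapCoord 0 j k x) k 0 (x k 0)) +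
        (linePhase α (swapCoord 0 j k x) j 1 (x k 1) -
          linePhase α (swapCoord 0 j k x) j 1 (x j 1)) +
        (linePhase α (swapCoord 1 j k (swapCoord 0 j k x)) k 1 (x j 1) -
          linePhase α (swapCoord 1 j k (swapCoord 0 j k x)) k 1 (x k 1)) =
        α * (2 * (Real.pi / 2 * ε) + ∑ m ∈ T, ε * (if b m then 2 * Real.pi else 0)) := by
      have hterm : ∑ m ∈ T, ε * (if b m then 2 * Real.pi else 0) =
          ∑ m ∈ T, (((pairPhase 0 (x j 1 - x m 1) (x k 0 - x m 0)
              - pairPhase 0 (x j 1 - x m 1) (x j 0 - x m 0))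
            + (pairPhase 0 (x k 1 - x m 1) (x j 0 - x m 0)
              - pairPhase 0 (x k 1 - x m 1) (x k 0 - x m 0)))
            + (pairPhase 1 (x k 0 - x m 0) (x k 1 - x m 1)
              - pairPhase 1 (x k 0 - x m 0) (x j 1 - x m 1))
            + (pairPhase 1 (x j 0 - x m 0) (x j 1 - x m 1)
              - pairPhase 1 (x j 0 - x m 0) (x k 1 - x m 1))) := by
        refine Finset.sum_congr rfl fun m hm => ?_
        have h := hw m (by simpa [hT] using hm)
        simp only [sub_sub_sub_cancel_right] at h
        rw [hε, ← h]
        simp only [pairPhase, if_true, one_ne_zero, if_false]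
        ring
      have hcongr : ∀ (i : Fin 2) (y : Fin n → EuclideanSpace ℝ (Fin 2)) (d t : ℝ),
          (∀ m ∈ T, ∀ l, y m l = x m l) →
          ∑ m ∈ T, pairPhase i (d - y m (1 - i)) (t - y m i) =
            ∑ m ∈ T, pairPhase i (d - x m (1 - i)) (t - x m i) := by
        intro i y d t hy
        refine Finset.sum_congr rfl fun m hm => ?_
        rw [hy m hm, hy m hm]
      have hS0 : ∀ m ∈ T, ∀ l, swapCoord 0 j k x m l = x m l := by
        intro m hm l
        have hm' : m ≠ j ∧ m ≠ k := by simpa [hT] using hm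
        simp [swapCoord_apply, Equiv.swap_apply_of_ne_of_ne hm'.1 hm'.2]
      have hS1 : ∀ m ∈ T, ∀ l, swapCoord 1 j k (swapCoord 0 j k x) m l = x m l := by
        intro m hm l
        have hm' : m ≠ j ∧ m ≠ k := by simpa [hT] using hm
        simp [swapCoord_one_swapCoord_zero, Equiv.swap_apply_of_ne_of_ne hm'.1 hm'.2]
      simp only [linePhase, sum_filter_ne_eq_add hjk, sum_filter_ne_eq_add hjk.symm, ← hT, hT',
        hcongr _ _ _ _ hS0, hcongr _ _ _ _ hS1]
      rw [hterm]
      simp only [Finset.sum_add_distrib, Finset.sum_sub_distrib]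
      rw [← hpair]
      have hx_sub : (x j 0 - x k 0) / (x k 1 - x j 1) = -((x j 0 - x k 0) / (x j 1 - x k 1)) := by
        rw [← div_neg]; simp
      have hy_sub : (x j 1 - x k 1) / (x k 0 - x j 0) = -((x j 1 - x k 1) / (x j 0 - x k 0)) := by
        rw [← div_neg]; simp
      simp [swapCoord_apply, pairPhase, hx_sub, hy_sub, Real.arctan_neg]
      ring
    rw [htot, hsum, show α * (2 * (Real.pi / 2 * ε) + ε * (2 * Real.pi * (T.filter b).card)) =
      ε * ((2 * ((T.filter b).card : ℝ) + 1) * α * Real.pi) by ring, abs_mul, hεabs, one_mul]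

/-- The open box `∏ᵢ (cᵢ, cᵢ + s)` raised to the power `n`. -/
def configBox (n : ℕ) (c : Fin 2 → ℝ) (s : ℝ) : Set (Fin n → EuclideanSpace ℝ (Fin 2)) :=
  {x | ∀ m l, x m l ∈ Set.Ioo (c l) (c l + s)}

/-- Pointwise exclusion bound obtained by exchanging the particles `j` and `k` along the rectangle
they span. -/
lemma sq_Calpha_mul_sq_norm_le (α : ℝ) {ψ : (Fin n → EuclideanSpace ℝ (Fin 2)) → ℂ}
    (hψ : ContDiff ℝ (⊤ : ℕ∞) ψ)
    (hsym : ∀ (σ : Equiv.Perm (Fin n)) (x : Fin n → EuclideanSpace ℝ (Fin 2)), ψ (x ∘ σ) = ψ x)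
    (hsupp : ∀ x ∈ tsupport ψ, ∀ j k : Fin n, j ≠ k → x j ≠ x k)
    {c : Fin 2 → ℝ} {s : ℝ} (hs : 0 < s) {x : Fin n → EuclideanSpace ℝ (Fin 2)}
    (hbox : x ∈ configBox n c s) (hx : ∀ l, Function.Injective fun m => x m l)
    {j k : Fin n} (hjk : j ≠ k) :
    Calpha α n ^ 2 * ‖ψ x‖ ^ 2 ≤ s *
      ((∫ t in Set.Ioo (c 0) (c 0 + s), ‖anyonD α ψ (setCoord x j 0 t) j 0‖ ^ 2) +
      (∫ t in Set.Ioo (c 0) (c 0 + s),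
        ‖anyonD α ψ (setCoord (swapCoord 0 j k x) k 0 t) k 0‖ ^ 2) +
      (∫ t in Set.Ioo (c 1) (c 1 + s),
        ‖anyonD α ψ (setCoord (swapCoord 0 j k x) j 1 t) j 1‖ ^ 2) +
      ∫ t in Set.Ioo (c 1) (c 1 + s),
        ‖anyonD α ψ (setCoord (swapCoord 1 j k (swapCoord 0 j k x)) k 1 t) k 1‖ ^ 2) := by
  obtain ⟨p, hp, hφ⟩ := exists_exchange_phase α hx hjk
  have hC := two_mul_Calpha_le_norm_exp_sub_one α hp hφ
  have hC0 : 0 ≤ Calpha α n :=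
    Real.sInf_nonneg (by rintro c ⟨p, q, -, rfl⟩; exact abs_nonneg _)
  have hx₀ := injective_swapCoord_coord hx 0 j k
  have hx₁ := injective_swapCoord_coord hx₀ 1 j k
  have m₁ := sq_norm_transport_sub_le α hψ hsupp (j := j) (i := 0)
    (fun m hm => (hx _).ne (Ne.symm hm)) hs (hbox j 0) (hbox k 0)
  have m₂ := sq_norm_transport_sub_le α hψ hsupp (j := k) (i := 0)
    (fun m hm => (hx₀ _).ne (Ne.symm hm)) hs (hbox k 0) (hbox j 0)
  have m₃ := sq_norm_transport_sub_le α hψ hsupp (j := j) (i := 1)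
    (fun m hm => (hx₀ _).ne (Ne.symm hm)) hs (hbox j 1) (hbox k 1)
  have m₄ := sq_norm_transport_sub_le α hψ hsupp (j := k) (i := 1)
    (fun m hm => (hx₁ _).ne (Ne.symm hm)) hs (hbox k 1) (hbox j 1)
  have v₁ : setCoord (swapCoord 0 j k x) k 0 (x k 0) = setCoord x j 0 (x k 0) :=
    config_ext fun m l => by
      simp only [setCoord_apply, swapCoord_apply, Equiv.swap_apply_def]; grind
  have v₂ : setCoord (swapCoord 0 j k x) k 0 (x j 0) = swapCoord 0 j k x :=
    setCoord_eq_self (by simp [swapCoord_apply])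
  have v₃ : setCoord (swapCoord 0 j k x) j 1 (x j 1) = swapCoord 0 j k x :=
    setCoord_eq_self rfl
  have v₄ : setCoord (swapCoord 1 j k (swapCoord 0 j k x)) k 1 (x k 1) =
      setCoord (swapCoord 0 j k x) j 1 (x k 1) :=
    config_ext fun m l => by
      simp only [setCoord_apply, swapCoord_apply, Equiv.swap_apply_def]; grind
  have v₅ : setCoord (swapCoord 1 j k (swapCoord 0 j k x)) k 1 (x j 1) = x ∘ Equiv.swap j k := by
    rw [← swapCoord_one_swapCoord_zero]
    exact setCoord_eq_self (by simp [swapCoord_apply])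
  rw [setCoord_eq_self (x := x) (j := j) (i := 0) rfl] at m₁
  rw [v₁, v₂] at m₂
  rw [v₃] at m₃
  rw [v₄, v₅, hsym] at m₄
  generalize linePhase α x j 0 (x k 0) - linePhase α x j 0 (x j 0) = φ₁ at m₁ hC
  generalize linePhase α (swapCoord 0 j k x) k 0 (x j 0) -
    linePhase α (swapCoord 0 j k x) k 0 (x k 0) = φ₂ at m₂ hC
  generalize linePhase α (swapCoord 0 j k x) j 1 (x k 1) -
    linePhase α (swapCoord 0 j k x) j 1 (x j 1) = φ₃ at m₃ hC
  generalize linePhase α (swapCoord 1 j k (swapCoord 0 j k x)) k 1 (x j 1) -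
    linePhase α (swapCoord 1 j k (swapCoord 0 j k x)) k 1 (x k 1) = φ₄ at m₄ hC
  generalize ψ (setCoord x j 0 (x k 0)) = ψ₁ at m₁ m₂
  generalize ψ (swapCoord 0 j k x) = ψ₂ at m₂ m₃
  generalize ψ (setCoord (swapCoord 0 j k x) j 1 (x k 1)) = ψ₃ at m₃ m₄
  set e : ℝ → ℂ := fun φ => Complex.exp (Complex.I * (φ : ℂ)) with he
  have hen : ∀ φ, ‖e φ‖ = 1 := fun φ => Complex.norm_exp_I_mul_ofReal φ
  have hadd : e (φ₁ + φ₂ + φ₃ + φ₄) = e φ₁ * e φ₂ * e φ₃ * e φ₄ := by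
    simp only [he, ← Complex.exp_add]; congr 1; push_cast; ring
  have htele : (e (φ₁ + φ₂ + φ₃ + φ₄) - 1) * ψ x = (e φ₁ * ψ₁ - ψ x) + e φ₁ * (e φ₂ * ψ₂ - ψ₁) +
      e φ₁ * e φ₂ * (e φ₃ * ψ₃ - ψ₂) + e φ₁ * e φ₂ * e φ₃ * (e φ₄ * ψ x - ψ₃) := by
    rw [hadd]; ring
  have htri : 2 * Calpha α n * ‖ψ x‖ ≤ ‖e φ₁ * ψ₁ - ψ x‖ + ‖e φ₂ * ψ₂ - ψ₁‖ +
      ‖e φ₃ * ψ₃ - ψ₂‖ + ‖e φ₄ * ψ x - ψ₃‖ := by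
    calc 2 * Calpha α n * ‖ψ x‖ ≤ ‖e (φ₁ + φ₂ + φ₃ + φ₄) - 1‖ * ‖ψ x‖ := by gcongr
      _ = _ := (norm_mul _ _).symm
      _ ≤ _ := by
        rw [htele]
        refine norm_add₄_le.trans (le_of_eq ?_)
        simp only [norm_mul, hen, one_mul]
  have hsq : (2 * Calpha α n * ‖ψ x‖) ^ 2 ≤ (‖e φ₁ * ψ₁ - ψ x‖ + ‖e φ₂ * ψ₂ - ψ₁‖ +
      ‖e φ₃ * ψ₃ - ψ₂‖ + ‖e φ₄ * ψ x - ψ₃‖) ^ 2 := by gcongr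
  change ‖e φ₁ * ψ₁ - ψ x‖ ^ 2 ≤ _ at m₁
  change ‖e φ₂ * ψ₂ - ψ₁‖ ^ 2 ≤ _ at m₂
  change ‖e φ₃ * ψ₃ - ψ₂‖ ^ 2 ≤ _ at m₃
  change ‖e φ₄ * ψ x - ψ₃‖ ^ 2 ≤ _ at m₄
  have hqm : ∀ a b c d : ℝ, (a + b + c + d) ^ 2 ≤ 4 * (a ^ 2 + b ^ 2 + c ^ 2 + d ^ 2) :=
    fun a b c d => by
      nlinarith [sq_nonneg (a - b), sq_nonneg (a - c), sq_nonneg (a - d), sq_nonneg (b - c),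
        sq_nonneg (b - d), sq_nonneg (c - d)]
  have hfin := hsq.trans (hqm _ _ _ _)
  rw [mul_pow, mul_pow] at hfin
  linarith

end exchange

section integration

open scoped ENNReal

variable {n : ℕ} {c : Fin 2 → ℝ} {s : ℝ}

lemma continuous_config_coord (m : Fin n) (l : Fin 2) :
    Continuous fun x : Fin n → EuclideanSpace ℝ (Fin 2) => x m l := by
  fun_prop

lemma measurableSet_configBox : MeasurableSet (configBox n c s) := by
  have : configBox n c s = ⋂ m, ⋂ l, (fun x => x m l) ⁻¹' Set.Ioo (c l) (c l + s) := by
    ext x; simp [configBox]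
  rw [this]
  exact MeasurableSet.iInter fun m => MeasurableSet.iInter fun l =>
    (continuous_config_coord m l).measurable measurableSet_Ioo

lemma integrableOn_configBox {f : (Fin n → EuclideanSpace ℝ (Fin 2)) → ℝ} (hf : Continuous f) :
    IntegrableOn f (configBox n c s) := by
  have hK : IsCompact (Set.univ.pi fun _ : Fin n =>
      (WithLp.toLp 2 : (Fin 2 → ℝ) → EuclideanSpace ℝ (Fin 2)) ''
        Set.univ.pi fun l => Set.Icc (c l) (c l + s)) :=
    isCompact_univ_pi fun _ =>
      (isCompact_univ_pi fun _ => isCompact_Icc).image (PiLp.continuous_toLp 2 _)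
  refine (hf.continuousOn.integrableOn_compact hK).mono_set fun x hx m _ => ?_
  exact ⟨(x m).ofLp, fun l _ => Set.Ioo_subset_Icc_self (hx m l), rfl⟩

lemma measurePreserving_swapCoord (l : Fin 2) (j k : Fin n) :
    MeasurePreserving (swapCoord l j k) := by
  have hsq : (swapCoord l j k).comp (swapCoord l j k) = LinearMap.id :=
    LinearMap.ext fun x => swapCoord_swapCoord l j k x
  have hdet : LinearMap.det (swapCoord l j k) * LinearMap.det (swapCoord l j k) = 1 := by
    rw [← LinearMap.det_comp, hsq, LinearMap.det_id]
  have habs : |LinearMap.det (swapCoord l j k)| = 1 := by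
    rcases mul_self_eq_one_iff.mp hdet with h | h <;> simp [h]
  refine ⟨(swapCoord l j k).continuous_of_finiteDimensional.measurable, ?_⟩
  rw [Measure.map_linearMap_addHaar_eq_smul_addHaar _ (left_ne_zero_of_mul_eq_one hdet), abs_inv,
    habs, inv_one, ENNReal.ofReal_one, one_smul]

lemma lintegral_configBox_swapCoord {H : (Fin n → EuclideanSpace ℝ (Fin 2)) → ℝ≥0∞}
    (hH : Measurable H) (l : Fin 2) (j k : Fin n) :
    ∫⁻ x in configBox n c s, H (swapCoord l j k x) = ∫⁻ x in configBox n c s, H x := by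
  have hpre : swapCoord l j k ⁻¹' configBox n c s = configBox n c s := by
    have hsub : ∀ x ∈ configBox n c s, swapCoord l j k x ∈ configBox n c s := by
      intro x hx m i
      rw [swapCoord_apply]
      split_ifs
      exacts [hx _ _, hx _ _]
    refine Set.Subset.antisymm (fun x hx => ?_) hsub
    simpa only [swapCoord_swapCoord] using hsub _ hx
  conv_lhs => rw [← hpre]
  exact (measurePreserving_swapCoord l j k).setLIntegral_comp_preimage measurableSet_configBox hH

/-- Fubini for a single coordinate: replacing a coordinate by an independent variable in the same
interval multiplies the integral over the box by the length of the interval. -/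
lemma lintegral_configBox_setCoord {H : (Fin n → EuclideanSpace ℝ (Fin 2)) → ℝ≥0∞}
    (hH : Measurable H) (j : Fin n) (i : Fin 2) :
    ∫⁻ x in configBox n c s, ∫⁻ t in Set.Ioo (c i) (c i + s), H (setCoord x j i t) =
      ENNReal.ofReal s * ∫⁻ x in configBox n c s, H x := by
  set J : ℝ → ℝ≥0∞ := (Set.Ioo (c i) (c i + s)).indicator 1 with hJ
  set K : (Fin n → EuclideanSpace ℝ (Fin 2)) → ℝ≥0∞ := (configBox n c s).indicator H with hK
  have hJm : Measurable J := measurable_one.indicator measurableSet_Ioo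
  have hKm : Measurable K := hH.indicator measurableSet_configBox
  have hcoord : Measurable fun x : Fin n → EuclideanSpace ℝ (Fin 2) => x j i :=
    (continuous_config_coord j i).measurable
  have hmem : ∀ x t, x j i ∈ Set.Ioo (c i) (c i + s) → t ∈ Set.Ioo (c i) (c i + s) →
      (setCoord x j i t ∈ configBox n c s ↔ x ∈ configBox n c s) := by
    intro x t hx ht
    refine forall_congr' fun m => forall_congr' fun l => ?_
    rw [setCoord_apply]
    split_ifs with h
    · obtain ⟨rfl, rfl⟩ := h
      exact iff_of_true ht hx
    · rfl
  have hpt : ∀ x t, (configBox n c s).indicator (fun x =>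
      (Set.Ioo (c i) (c i + s)).indicator (fun t => H (setCoord x j i t)) t) x =
      J (x j i) * K (setCoord x j i t) := by
    intro x t
    by_cases hx : x j i ∈ Set.Ioo (c i) (c i + s)
    · by_cases ht : t ∈ Set.Ioo (c i) (c i + s)
      · by_cases hb : x ∈ configBox n c s
        · have hb' := (hmem x t hx ht).mpr hb
          simp only [hJ, hK, Set.indicator_of_mem, hx, ht, hb, hb', Pi.one_apply, one_mul]
        · have hb' := mt (hmem x t hx ht).mp hb
          simp only [hK, Set.indicator_of_notMem, hb, hb', not_false_eq_true, mul_zero]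
      · have hb' : setCoord x j i t ∉ configBox n c s := fun h => ht <| by
          simpa [setCoord_apply] using h j i
        simp only [hK, Set.indicator_of_notMem, ht, hb', not_false_eq_true, mul_zero]
        exact congrFun (Set.indicator_zero ℝ≥0∞ _) x
    · have hb : x ∉ configBox n c s := fun h => hx (h j i)
      simp only [hJ, Set.indicator_of_notMem, hx, hb, not_false_eq_true, zero_mul]
  have hdir : coordDir j i j i = 1 := by simp [coordDir]
  calc ∫⁻ x in configBox n c s, ∫⁻ t in Set.Ioo (c i) (c i + s), H (setCoord x j i t)
      = ∫⁻ x, ∫⁻ t, J (x j i) * K (setCoord x j i t) := by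
        rw [← lintegral_indicator measurableSet_configBox]
        refine lintegral_congr fun x => ?_
        simp only [← hpt]
        by_cases hb : x ∈ configBox n c s
        · simp only [Set.indicator_of_mem hb, lintegral_indicator measurableSet_Ioo]
        · simp only [Set.indicator_of_notMem hb, lintegral_zero]
    _ = ∫⁻ x, ∫⁻ u : ℝ, J (x j i) * K (x + u • coordDir j i) := by
        refine lintegral_congr fun x => ?_
        exact lintegral_sub_right_eq_self (fun u => J (x j i) * K (x + u • coordDir j i)) (x j i)
    _ = ∫⁻ u : ℝ, ∫⁻ x, J (x j i) * K (x + u • coordDir j i) := by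
        refine lintegral_lintegral_swap (Measurable.aemeasurable ?_)
        refine (hJm.comp (hcoord.comp measurable_fst)).mul (hKm.comp ?_)
        exact (by fun_prop : Continuous fun z : (Fin n → EuclideanSpace ℝ (Fin 2)) × ℝ =>
          z.1 + z.2 • coordDir j i).measurable
    _ = ∫⁻ u : ℝ, ∫⁻ y, J (y j i - u) * K y := by
        refine lintegral_congr fun u => ?_
        rw [← lintegral_add_right_eq_self (fun y => J (y j i - u) * K y) (u • coordDir j i)]
        refine lintegral_congr fun x => ?_
        simp [hdir]
    _ = ∫⁻ y, ∫⁻ u : ℝ, J (y j i - u) * K y := by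
        refine lintegral_lintegral_swap (Measurable.aemeasurable ?_)
        exact (hJm.comp ((hcoord.comp measurable_snd).sub measurable_fst)).mul
          (hKm.comp measurable_snd)
    _ = ∫⁻ y, ENNReal.ofReal s * K y := by
        refine lintegral_congr fun y => ?_
        have hJy : Measurable fun u => J (y j i - u) := hJm.comp (measurable_const.sub measurable_id)
        rw [lintegral_mul_const _ hJy,
          lintegral_sub_left_eq_self J (y j i), hJ, lintegral_indicator_one measurableSet_Ioo,
          Real.volume_Ioo, add_sub_cancel_left]
    _ = ENNReal.ofReal s * ∫⁻ x in configBox n c s, H x := by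
        rw [lintegral_const_mul _ hKm, hK, lintegral_indicator measurableSet_configBox]

lemma ae_injective_coord :
    ∀ᵐ x : Fin n → EuclideanSpace ℝ (Fin 2), ∀ l, Function.Injective fun m => x m l := by
  have h : ∀ l : Fin 2, ∀ m m' : Fin n, m ≠ m' →
      ∀ᵐ x : Fin n → EuclideanSpace ℝ (Fin 2), x m l ≠ x m' l := by
    intro l m m' hm
    let W : Submodule ℝ (Fin n → EuclideanSpace ℝ (Fin 2)) :=
      { carrier := {x | x m l = x m' l}
        add_mem' := fun {x y} hx hy => by
          simp only [Set.mem_ofPred_eq] at hx hy ⊢; simp [hx, hy]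
        zero_mem' := by simp
        smul_mem' := fun a x hx => by simp only [Set.mem_ofPred_eq] at hx ⊢; simp [hx] }
    have hW : W ≠ ⊤ := fun htop => by
      have : coordDir m l ∈ W := htop ▸ Submodule.mem_top
      have h' : coordDir m l m l = coordDir m l m' l := this
      simp [coordDir, hm.symm] at h'
    exact measure_eq_zero_iff_ae_notMem.mp (Measure.addHaar_submodule volume W hW)
  have h' : ∀ᵐ x : Fin n → EuclideanSpace ℝ (Fin 2), ∀ l, ∀ m m' : Fin n, m ≠ m' →
      x m l ≠ x m' l := by
    simp only [ae_all_iff]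
    exact h
  filter_upwards [h'] with x hx l m m' hmm
  by_contra hne
  exact hx l m m' hne hmm

/-- Exclusion bound for a single pair of particles. -/
lemma sq_Calpha_mul_integral_le (α : ℝ) {ψ : (Fin n → EuclideanSpace ℝ (Fin 2)) → ℂ}
    (hψ : ContDiff ℝ (⊤ : ℕ∞) ψ)
    (hsym : ∀ (σ : Equiv.Perm (Fin n)) (x : Fin n → EuclideanSpace ℝ (Fin 2)), ψ (x ∘ σ) = ψ x)
    (hsupp : ∀ x ∈ tsupport ψ, ∀ j k : Fin n, j ≠ k → x j ≠ x k) (hs : 0 < s)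
    {j k : Fin n} (hjk : j ≠ k) :
    Calpha α n ^ 2 * ∫ x in configBox n c s, ‖ψ x‖ ^ 2 ≤
      s ^ 2 * ((∑ i, ∫ x in configBox n c s, ‖anyonD α ψ x j i‖ ^ 2) +
        ∑ i, ∫ x in configBox n c s, ‖anyonD α ψ x k i‖ ^ 2) := by
  have hDc : ∀ m i, Continuous fun x => ‖anyonD α ψ x m i‖ ^ 2 := fun m i =>
    (continuous_anyonD α hψ hsupp m i).norm.pow 2
  set N : Fin n → Fin 2 → (Fin n → EuclideanSpace ℝ (Fin 2)) → ℝ≥0∞ :=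
    fun m i x => ENNReal.ofReal (‖anyonD α ψ x m i‖ ^ 2) with hN
  have hNm : ∀ m i, Measurable (N m i) := fun m i => (hDc m i).measurable.ennreal_ofReal
  have hline : ∀ m i y, ENNReal.ofReal
      (∫ t in Set.Ioo (c i) (c i + s), ‖anyonD α ψ (setCoord y m i t) m i‖ ^ 2) =
      ∫⁻ t in Set.Ioo (c i) (c i + s), N m i (setCoord y m i t) := fun m i y =>
    ofReal_integral_eq_lintegral_ofReal
      ((((hDc m i).comp (continuous_setCoord y m i)).continuousOn.integrableOn_compact
        isCompact_Icc).mono_set Set.Ioo_subset_Icc_self)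
      (Filter.Eventually.of_forall fun t => sq_nonneg _)
  have hbox : ∀ m i, ENNReal.ofReal (∫ x in configBox n c s, ‖anyonD α ψ x m i‖ ^ 2) =
      ∫⁻ x in configBox n c s, N m i x := fun m i =>
    ofReal_integral_eq_lintegral_ofReal (integrableOn_configBox (hDc m i))
      (Filter.Eventually.of_forall fun t => sq_nonneg _)
  set M : Fin n → Fin 2 → (Fin n → EuclideanSpace ℝ (Fin 2)) → ℝ≥0∞ :=
    fun m i y => ∫⁻ t in Set.Ioo (c i) (c i + s), N m i (setCoord y m i t) with hM
  have hMm : ∀ m i, Measurable (M m i) := fun m i => by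
    refine Measurable.lintegral_prod_right ((hNm m i).comp ?_)
    refine Continuous.measurable ?_
    unfold setCoord
    fun_prop
  have hSm : ∀ l, Measurable (swapCoord l j k) := fun l =>
    (swapCoord l j k).continuous_of_finiteDimensional.measurable
  have hMint : ∀ m i, ∫⁻ y in configBox n c s, M m i y =
      ENNReal.ofReal s * ∫⁻ x in configBox n c s, N m i x := fun m i =>
    lintegral_configBox_setCoord (hNm m i) m i
  have hpt : ∀ᵐ x ∂volume.restrict (configBox n c s),
      ENNReal.ofReal (Calpha α n ^ 2 * ‖ψ x‖ ^ 2) ≤ ENNReal.ofReal s *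
        (M j 0 x + M k 0 (swapCoord 0 j k x) + M j 1 (swapCoord 0 j k x) +
          M k 1 (swapCoord 1 j k (swapCoord 0 j k x))) := by
    filter_upwards [ae_restrict_of_ae ae_injective_coord,
      ae_restrict_mem measurableSet_configBox] with x hx hxb
    have h0 : ∀ m i y, 0 ≤ ∫ t in Set.Ioo (c i) (c i + s),
        ‖anyonD α ψ (setCoord y m i t) m i‖ ^ 2 := fun m i y =>
      integral_nonneg fun t => sq_nonneg _
    have h := ENNReal.ofReal_le_ofReal (sq_Calpha_mul_sq_norm_le α hψ hsym hsupp hs hxb hx hjk)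
    rwa [ENNReal.ofReal_mul hs.le, ENNReal.ofReal_add (by simp only [h0, add_nonneg]) (h0 _ _ _),
      ENNReal.ofReal_add (by simp only [h0, add_nonneg]) (h0 _ _ _),
      ENNReal.ofReal_add (h0 _ _ _) (h0 _ _ _), hline, hline, hline, hline] at h
  have hint := lintegral_mono_ae hpt
  have hS₀ : ∀ m i, Measurable fun x => M m i (swapCoord 0 j k x) := fun m i =>
    (hMm m i).comp (hSm 0)
  have hS₁ : ∀ m i, Measurable fun x => M m i (swapCoord 1 j k x) := fun m i =>
    (hMm m i).comp (hSm 1)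
  have hS₀₁ : Measurable fun x => M k 1 (swapCoord 1 j k (swapCoord 0 j k x)) :=
    (hS₁ k 1).comp (hSm 0)
  have hψc : Continuous fun x => Calpha α n ^ 2 * ‖ψ x‖ ^ 2 :=
    continuous_const.mul (hψ.continuous.norm.pow 2)
  have hsplit : ∫⁻ x in configBox n c s, ENNReal.ofReal s *
        (M j 0 x + M k 0 (swapCoord 0 j k x) + M j 1 (swapCoord 0 j k x) +
          M k 1 (swapCoord 1 j k (swapCoord 0 j k x))) =
      ENNReal.ofReal s * ((∫⁻ x in configBox n c s, M j 0 x) +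
        (∫⁻ x in configBox n c s, M k 0 x) + (∫⁻ x in configBox n c s, M j 1 x) +
        ∫⁻ x in configBox n c s, M k 1 x) := by
    rw [lintegral_const_mul' _ _ ENNReal.ofReal_ne_top,
      lintegral_add_right _ hS₀₁, lintegral_add_right _ (hS₀ j 1),
      lintegral_add_right _ (hS₀ k 0), lintegral_configBox_swapCoord (hMm k 0),
      lintegral_configBox_swapCoord (hMm j 1)]
    congr 2
    exact (lintegral_configBox_swapCoord (hS₁ k 1) 0 j k).trans
      (lintegral_configBox_swapCoord (hMm k 1) 1 j k)
  rw [hsplit, hMint, hMint, hMint, hMint, ← hbox, ← hbox, ← hbox, ← hbox,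
    ← ofReal_integral_eq_lintegral_ofReal
      (integrableOn_configBox hψc)
      (Filter.Eventually.of_forall fun t => by positivity), integral_const_mul] at hint
  have h0 : ∀ m i, 0 ≤ ∫ x in configBox n c s, ‖anyonD α ψ x m i‖ ^ 2 := fun m i =>
    integral_nonneg fun t => sq_nonneg _
  have h1 : ∀ m i, 0 ≤ s * ∫ x in configBox n c s, ‖anyonD α ψ x m i‖ ^ 2 := fun m i =>
    mul_nonneg hs.le (h0 m i)
  simp only [← ENNReal.ofReal_mul hs.le] at hint
  rw [← ENNReal.ofReal_add (h1 _ _) (h1 _ _), ← ENNReal.ofReal_add (by positivity) (h1 _ _),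
    ← ENNReal.ofReal_add (by positivity) (h1 _ _), ← ENNReal.ofReal_mul hs.le,
    ENNReal.ofReal_le_ofReal_iff (by positivity)] at hint
  refine hint.trans (le_of_eq ?_)
  simp only [Fin.sum_univ_two]
  ring

end integration

/-- **Local exclusion for anyons on a square.** For a symmetric wave function of `n` anyons
supported away from the diagonals and an open square `Ω ⊆ ℝ²` of area `s²`,
`∫_{Ωⁿ} ∑_j ‖D_jψ‖² ≥ (n-1)·0.112·C_{α,n}²/|Ω| · ∫_{Ωⁿ} |ψ|²`. -/
theorem local_exclusion_anyons_square
    (α : ℝ) (n : ℕ) (hn : 2 ≤ n) (c₁ c₂ s : ℝ) (hs : 0 < s)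
    (Ω : Set (EuclideanSpace ℝ (Fin 2)))
    (hΩ : Ω = {y : EuclideanSpace ℝ (Fin 2) |
      y 0 ∈ Set.Ioo c₁ (c₁ + s) ∧ y 1 ∈ Set.Ioo c₂ (c₂ + s)})
    (ψ : (Fin n → EuclideanSpace ℝ (Fin 2)) → ℂ) (hψ : ContDiff ℝ (⊤ : ℕ∞) ψ)
    (hsym : ∀ (σ : Equiv.Perm (Fin n)) (x : Fin n → EuclideanSpace ℝ (Fin 2)),
      ψ (x ∘ σ) = ψ x)
    (hsupp : ∀ x ∈ tsupport ψ, ∀ j k : Fin n, j ≠ k → x j ≠ x k) :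
    (∫ x in Set.univ.pi fun _ : Fin n => Ω,
        ∑ j : Fin n, ∑ i : Fin 2, ‖anyonD α ψ x j i‖ ^ 2)
      ≥ ((n : ℝ) - 1) * (0.112 * Calpha α n ^ 2 / s ^ 2) *
        ∫ x in Set.univ.pi fun _ : Fin n => Ω, ‖ψ x‖ ^ 2 := by
  have hbox : (Set.univ.pi fun _ : Fin n => Ω) = configBox n ![c₁, c₂] s := by
    ext x; simp [hΩ, configBox, Fin.forall_fin_two]
  rw [hbox]
  have hDc : ∀ j i, Continuous fun x => ‖anyonD α ψ x j i‖ ^ 2 := fun j i =>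
    (continuous_anyonD α hψ hsupp j i).norm.pow 2
  set E : Fin n → ℝ := fun j => ∑ i, ∫ x in configBox n ![c₁, c₂] s, ‖anyonD α ψ x j i‖ ^ 2 with hE
  have hsum : ∫ x in configBox n ![c₁, c₂] s, ∑ j : Fin n, ∑ i : Fin 2, ‖anyonD α ψ x j i‖ ^ 2 =
      ∑ j, E j := by
    rw [integral_finsetSum _ fun j _ => integrable_finsetSum _ fun i _ =>
      integrableOn_configBox (hDc j i)]
    exact Finset.sum_congr rfl fun j _ => integral_finsetSum _ fun i _ =>
      integrableOn_configBox (hDc j i)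
  rw [hsum]
  have hP : 0 ≤ ∫ x in configBox n ![c₁, c₂] s, ‖ψ x‖ ^ 2 := integral_nonneg fun x => sq_nonneg _
  obtain ⟨σ, hσ⟩ : ∃ σ : Equiv.Perm (Fin n), ∀ j, j ≠ σ j := by
    obtain ⟨m, rfl⟩ := Nat.exists_eq_add_of_le' hn
    exact ⟨Equiv.addRight 1, fun j => by simp⟩
  have hpairs : ∑ _j : Fin n, Calpha α n ^ 2 * ∫ x in configBox n ![c₁, c₂] s, ‖ψ x‖ ^ 2 ≤
      ∑ j, s ^ 2 * (E j + E (σ j)) :=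
    Finset.sum_le_sum fun j _ => sq_Calpha_mul_integral_le α hψ hsym hsupp hs (hσ j)
  rw [Finset.sum_const, Finset.card_univ, Fintype.card_fin, nsmul_eq_mul, ← Finset.mul_sum,
    Finset.sum_add_distrib, Equiv.sum_comp σ E] at hpairs
  set P : ℝ := ∫ x in configBox n ![c₁, c₂] s, ‖ψ x‖ ^ 2
  have hCP : 0 ≤ Calpha α n ^ 2 * P := by positivity
  have hn' : (2 : ℝ) ≤ n := by exact_mod_cast hn
  rw [ge_iff_le, show ((n : ℝ) - 1) * (0.112 * Calpha α n ^ 2 / s ^ 2) * P =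
    ((n : ℝ) - 1) * 0.112 * (Calpha α n ^ 2 * P) / s ^ 2 by ring, div_le_iff₀ (by positivity)]
  nlinarith
end
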